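/- arXiv:2208.13498 — 2 statements merged into one kernel-verified Lean document; each statement's English description precedes it below -/
import Mathlib

section
/- Strong minimum principle, L¹ coefficient, global nonnegativity: Let Ω ⊂ ℝⁿ be any open set, let c ∈ L¹_loc(Ω) with c(x) ≤ 0 in Ω, and let u ∈ W^{s,G}_loc(Ω) ∩ L^g_s(ℝⁿ) be a weak supersolution of 𝓛u = c(x)g(|u|)u/|u| in Ω with u ≥ 0 a.e. in ℝⁿ. Then either u > 0 a.e. in Ω or u = 0 a.e. in ℝⁿ. -/
open MeasureTheory Metric Set Filter Topology Bornology
open scoped Classical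

noncomputable section

/-- `n`-dimensional Euclidean space `ℝⁿ`. -/
abbrev Eucl (n : ℕ) : Type := EuclideanSpace ℝ (Fin n)

/-- Condition (1.3) on `g` together with the structural assumptions:
`g : [0,∞) → [0,∞)` continuous, strictly increasing, convex, `g 0 = 0`,
`g t → ∞`, differentiable on `(0,∞)` with `p_g ≤ t g'(t)/g(t) ≤ q_g`,
extended oddly to all of `ℝ` by `g (-t) = - g t`. -/
structure CondG (g : ℝ → ℝ) (pg qg : ℝ) : Prop where
  one_lt : 1 < pg
  pg_le_qg : pg ≤ qg
  cont : ContinuousOn g (Ici 0)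
  mono : StrictMonoOn g (Ici 0)
  convex : ConvexOn ℝ (Ici 0) g
  zero : g 0 = 0
  infty : Tendsto g atTop atTop
  diff : ∀ t : ℝ, 0 < t → DifferentiableAt ℝ g t
  lower : ∀ t : ℝ, 0 < t → pg * g t ≤ t * deriv g t
  upper : ∀ t : ℝ, 0 < t → t * deriv g t ≤ qg * g t
  odd : ∀ t : ℝ, g (-t) = - g t

/-- Assumptions on the kernel `K`: symmetry, translation invariance,
the growth condition `λ |x-y|^{-n} ≤ K x y ≤ Λ |x-y|^{-n}` (off the diagonal)
and continuity off the diagonal. -/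
structure CondK (n : ℕ) (K : Eucl n → Eucl n → ℝ) (lam Lam : ℝ) : Prop where
  lam_pos : 0 < lam
  lam_le_Lam : lam ≤ Lam
  symm : ∀ x y, K x y = K y x
  transl : ∀ x y z, K (x + z) (y + z) = K x y
  lower : ∀ x y : Eucl n, x ≠ y → lam / ‖x - y‖ ^ n ≤ K x y
  upper : ∀ x y : Eucl n, x ≠ y → K x y ≤ Lam / ‖x - y‖ ^ n
  cont : ContinuousOn (fun p : Eucl n × Eucl n => K p.1 p.2) {p | p.1 ≠ p.2}

/-- The Young function `G(t) = ∫₀ᵗ g(θ) dθ`. -/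
def GG (g : ℝ → ℝ) (t : ℝ) : ℝ := ∫ θ in (0:ℝ)..t, g θ

/-- `u ∈ L^g_s(ℝⁿ)`. -/
def MemLgs (n : ℕ) (s : ℝ) (g : ℝ → ℝ) (u : Eucl n → ℝ) : Prop :=
  Measurable u ∧
    Integrable (fun x : Eucl n => g (|u x| / (1 + ‖x‖) ^ s) / (1 + ‖x‖) ^ ((n : ℝ) + s))

/-- `u ∈ W^{s,G}(U)`. -/
def MemWsG (n : ℕ) (s : ℝ) (g : ℝ → ℝ) (u : Eucl n → ℝ) (U : Set (Eucl n)) : Prop :=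
  Measurable u ∧ IntegrableOn (fun x => GG g |u x|) U ∧
    IntegrableOn
      (fun p : Eucl n × Eucl n => GG g (|u p.1 - u p.2| / ‖p.1 - p.2‖ ^ s) / ‖p.1 - p.2‖ ^ n)
      (U ×ˢ U)

/-- `u ∈ W^{s,G}_loc(Ω)`. -/
def MemWsGloc (n : ℕ) (s : ℝ) (g : ℝ → ℝ) (u : Eucl n → ℝ) (Ω : Set (Eucl n)) : Prop :=
  ∀ Ω' : Set (Eucl n), IsOpen Ω' → IsBounded Ω' → closure Ω' ⊆ Ω →
    ∃ U : Set (Eucl n), IsOpen U ∧ closure Ω' ⊆ U ∧ MemWsG n s g u U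

/-- `η ∈ W^{s,G}₀(Ω)`. -/
def MemWsG0 (n : ℕ) (s : ℝ) (g : ℝ → ℝ) (Ω : Set (Eucl n)) (η : Eucl n → ℝ) : Prop :=
  MemWsG n s g η univ ∧ ∀ x ∉ Ω, η x = 0

/-- The nonlocal energy pairing
`∬ g((u(x)-u(y))/|x-y|^s) (η(x)-η(y)) K(x,y) |x-y|^{-s} dx dy`
(with `g` oddly extended, so that
`g((u(x)-u(y))/|x-y|^s) = g(|u(x)-u(y)|/|x-y|^s)·sgn(u(x)-u(y))`). -/
def energy (n : ℕ) (s : ℝ) (g : ℝ → ℝ) (K : Eucl n → Eucl n → ℝ) (u η : Eucl n → ℝ) : ℝ :=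
  ∫ p : Eucl n × Eucl n,
    g ((u p.1 - u p.2) / ‖p.1 - p.2‖ ^ s) * (η p.1 - η p.2) * K p.1 p.2 / ‖p.1 - p.2‖ ^ s

/-- `η ∈ C_c^∞(Ω')`. -/
def IsTest (n : ℕ) (Ω' : Set (Eucl n)) (η : Eucl n → ℝ) : Prop :=
  ContDiff ℝ (⊤ : ℕ∞) η ∧ HasCompactSupport η ∧ tsupport η ⊆ Ω'

/-- `u` is a weak supersolution of `𝓛 u = c(x) g(|u|) u/|u|` in `Ω`
(by the odd extension the right-hand side integrand is `c(x) g(u(x)) η(x)`). -/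
def WeakSupersol (n : ℕ) (s : ℝ) (g : ℝ → ℝ) (K : Eucl n → Eucl n → ℝ)
    (c : Eucl n → ℝ) (u : Eucl n → ℝ) (Ω : Set (Eucl n)) : Prop :=
  MemWsGloc n s g u Ω ∧ MemLgs n s g u ∧
    ∀ Ω' : Set (Eucl n), IsOpen Ω' → IsBounded Ω' → Ω' ⊆ Ω →
      ∀ η : Eucl n → ℝ, IsTest n Ω' η → (∀ x, 0 ≤ η x) →
        (∫ x in Ω, c x * g (u x) * η x) ≤ energy n s g K u η

/-- `u` is a weak solution of `𝓛 u = f` in `Ω`. -/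
def WeakSol (n : ℕ) (s : ℝ) (g : ℝ → ℝ) (K : Eucl n → Eucl n → ℝ)
    (f : Eucl n → ℝ) (u : Eucl n → ℝ) (Ω : Set (Eucl n)) : Prop :=
  MemWsGloc n s g u Ω ∧ MemLgs n s g u ∧
    ∀ Ω' : Set (Eucl n), IsOpen Ω' → IsBounded Ω' → Ω' ⊆ Ω →
      ∀ η : Eucl n → ℝ, IsTest n Ω' η →
        energy n s g K u η = ∫ x in Ω, f x * η x

/-- `Lpv n s g K w x L` says that the principal value
`𝓛 w (x) = p.v. ∫ g((w(x)-w(y))/|x-y|^s) K(x,y) |x-y|^{-s} dy` exists and equals `L`. -/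
def Lpv (n : ℕ) (s : ℝ) (g : ℝ → ℝ) (K : Eucl n → Eucl n → ℝ) (w : Eucl n → ℝ)
    (x : Eucl n) (L : ℝ) : Prop :=
  Tendsto (fun ε : ℝ =>
      ∫ y in (ball x ε)ᶜ, g ((w x - w y) / ‖x - y‖ ^ s) * K x y / ‖x - y‖ ^ s)
    (𝓝[>] 0) (𝓝 L)

/-- The critical set `N_ψ` of `ψ` in `D`. -/
def CritSet (n : ℕ) (ψ : Eucl n → ℝ) (D : Set (Eucl n)) : Set (Eucl n) :=
  {x ∈ D | fderiv ℝ ψ x = 0}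

/-- The class `C²_β(D)`. -/
def C2beta (n : ℕ) (ψ : Eucl n → ℝ) (D : Set (Eucl n)) (β : ℝ) : Prop :=
  ContDiffOn ℝ 2 ψ D ∧
    ∃ M : ℝ, ∀ x ∈ D,
      (min (infDist x (CritSet n ψ D)) 1) ^ (β - 1) / ‖fderiv ℝ ψ x‖ +
          ‖iteratedFDeriv ℝ 2 ψ x‖ / (infDist x (CritSet n ψ D)) ^ (β - 2) ≤ M

/-! ### Elementary facts on `g` -/

theorem CondG.nonneg {g : ℝ → ℝ} {pg qg : ℝ} (hg : CondG g pg qg) {t : ℝ} (ht : 0 ≤ t) :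
    0 ≤ g t := by
  have := hg.mono.monotoneOn (mem_Ici.2 le_rfl) (mem_Ici.2 ht) ht
  rwa [hg.zero] at this

theorem CondG.pos {g : ℝ → ℝ} {pg qg : ℝ} (hg : CondG g pg qg) {t : ℝ} (ht : 0 < t) :
    0 < g t := by
  have := hg.mono (mem_Ici.2 le_rfl) (mem_Ici.2 ht.le) ht
  rwa [hg.zero] at this

theorem CondG.le_of_le {g : ℝ → ℝ} {pg qg : ℝ} (hg : CondG g pg qg) {a b : ℝ} (ha : 0 ≤ a)
    (hab : a ≤ b) : g a ≤ g b :=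
  hg.mono.monotoneOn (mem_Ici.2 ha) (mem_Ici.2 (ha.trans hab)) hab

theorem CondG.abs_eq {g : ℝ → ℝ} {pg qg : ℝ} (hg : CondG g pg qg) (t : ℝ) :
    |g t| = g |t| := by
  rcases le_total 0 t with h | h
  · rw [abs_of_nonneg h, abs_of_nonneg (hg.nonneg h)]
  · have h1 := hg.odd t
    have h2 := hg.nonneg (neg_nonneg.2 h)
    rw [abs_of_nonpos h, h1, abs_of_nonpos (by linarith)]

theorem CondG.continuous {g : ℝ → ℝ} {pg qg : ℝ} (hg : CondG g pg qg) : Continuous g := by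
  have h : g = fun t => g (max t 0) - g (max (-t) 0) := by
    funext t
    rcases le_total 0 t with h | h
    · rw [max_eq_left h, max_eq_right (by linarith), hg.zero, sub_zero]
    · rw [max_eq_right h, max_eq_left (by linarith), hg.zero, hg.odd]; ring
  have h1 : Continuous fun t : ℝ => g (max t 0) :=
    hg.cont.comp_continuous (by fun_prop) (fun t => mem_Ici.2 (le_max_right _ _))
  have h2 : Continuous fun t : ℝ => g (max (-t) 0) :=
    hg.cont.comp_continuous (by fun_prop) (fun t => mem_Ici.2 (le_max_right _ _))
  rw [h]
  exact h1.sub h2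

theorem CondG.qg_pos {g : ℝ → ℝ} {pg qg : ℝ} (hg : CondG g pg qg) : 1 < qg :=
  hg.one_lt.trans_le hg.pg_le_qg

theorem CondG.div_le {g : ℝ → ℝ} {pg qg : ℝ} (hg : CondG g pg qg) {t T : ℝ} (ht : 0 ≤ t)
    (hT : 1 ≤ T) : g (t / T) ≤ g t / T := by
  have hT0 : 0 < T := by linarith
  have h := hg.convex.2 (mem_Ici.2 ht) (mem_Ici.2 (le_refl (0:ℝ)))
    (show 0 ≤ 1 / T by positivity)
    (show 0 ≤ 1 - 1 / T by rw [sub_nonneg, div_le_one hT0]; exact hT) (by ring)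
  simp only [smul_eq_mul, mul_zero, add_zero, hg.zero] at h
  calc g (t / T) = g (1 / T * t) := by congr 1; ring
    _ ≤ 1 / T * g t := h
    _ = g t / T := by ring

theorem CondG.mul_le {g : ℝ → ℝ} {pg qg : ℝ} (hg : CondG g pg qg) {t l : ℝ} (ht : 0 ≤ t)
    (hl : 1 ≤ l) : g (l * t) ≤ l ^ qg * g t := by
  rcases ht.eq_or_lt with rfl | ht
  · simp [hg.zero]
  have hanti : AntitoneOn (fun x => g x * x ^ (-qg)) (Ioi 0) := by
    apply antitoneOn_of_deriv_nonpos (convex_Ioi 0)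
    · intro x hx
      exact ((hg.continuous.continuousAt).mul
        (Real.continuousAt_rpow_const _ _ (Or.inl (ne_of_gt hx)))).continuousWithinAt
    · intro x hx
      rw [interior_Ioi] at hx
      exact ((hg.diff x hx).mul (Real.differentiableAt_rpow_const_of_ne _
        (ne_of_gt hx))).differentiableWithinAt
    · intro x hx
      rw [interior_Ioi] at hx
      have hx : 0 < x := hx
      have hd : HasDerivAt (fun x => g x * x ^ (-qg))
          (deriv g x * x ^ (-qg) + g x * (-qg * x ^ (-qg - 1))) x :=
        (hg.diff x hx).hasDerivAt.mul (Real.hasDerivAt_rpow_const (Or.inl hx.ne'))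
      rw [hd.deriv]
      have h1 : x ^ (-qg) = x * x ^ (-qg - 1) := by
        rw [Real.rpow_sub_one hx.ne']; field_simp
      have h2 := hg.upper x hx
      have h3 : 0 < x ^ (-qg - 1) := Real.rpow_pos_of_pos hx _
      rw [h1]
      nlinarith
  have hlt : t ≤ l * t := by nlinarith
  have h := hanti (mem_Ioi.2 ht) (mem_Ioi.2 (ht.trans_le hlt)) hlt
  have hl0 : 0 < l := by linarith
  simp only at h
  rw [Real.mul_rpow hl0.le ht.le, Real.rpow_neg hl0.le, Real.rpow_neg ht.le] at h
  have e1 : 0 < l ^ qg := Real.rpow_pos_of_pos hl0 _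
  have e2 : 0 < t ^ qg := Real.rpow_pos_of_pos ht _
  have := mul_le_mul_of_nonneg_right h (mul_pos e1 e2).le
  calc g (l * t) = g (l * t) * ((l ^ qg)⁻¹ * (t ^ qg)⁻¹) * (l ^ qg * t ^ qg) := by field_simp
    _ ≤ g t * (t ^ qg)⁻¹ * (l ^ qg * t ^ qg) := this
    _ = l ^ qg * g t := by field_simp

theorem CondG.le_GG {g : ℝ → ℝ} {pg qg : ℝ} (hg : CondG g pg qg) {t : ℝ} (ht : 0 ≤ t) :
    t * g t ≤ (qg + 1) * GG g t := by
  have hGd : ∀ x, HasDerivAt (GG g) (g x) x := fun x =>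
    intervalIntegral.integral_hasDerivAt_right (hg.continuous.intervalIntegrable _ _)
      (hg.continuous.stronglyMeasurableAtFilter _ _) hg.continuous.continuousAt
  have hm : MonotoneOn (fun x => (qg + 1) * GG g x - x * g x) (Ici 0) := by
    apply monotoneOn_of_deriv_nonneg (convex_Ici 0)
    · intro x hx
      exact ((continuousAt_const.mul (hGd x).continuousAt).sub
        (continuousAt_id.mul hg.continuous.continuousAt)).continuousWithinAt
    · intro x hx
      rw [interior_Ici] at hx
      exact (((hGd x).differentiableAt.const_mul _).sub
        (differentiableAt_id.mul (hg.diff x hx))).differentiableWithinAt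
    · intro x hx
      rw [interior_Ici] at hx
      have hd : HasDerivAt (fun x => (qg + 1) * GG g x - x * g x)
          ((qg + 1) * g x - (1 * g x + x * deriv g x)) x :=
        ((hGd x).const_mul _).sub ((hasDerivAt_id x).mul (hg.diff x hx).hasDerivAt)
      rw [hd.deriv]
      have := hg.upper x hx
      linarith
  have h := hm (mem_Ici.2 le_rfl) (mem_Ici.2 ht) ht
  simp [GG] at h
  simpa [GG] using h

/-- Young-type inequality with a small parameter `1 / T`. -/
theorem CondG.young {g : ℝ → ℝ} {pg qg : ℝ} (hg : CondG g pg qg) {a b T : ℝ} (ha : 0 ≤ a)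
    (hb : 0 ≤ b) (hT : 1 ≤ T) : g a * b ≤ T * (a * g a) + 1 / T * (b * g b) := by
  have hT0 : 0 < T := by linarith
  have hga := hg.nonneg ha
  have hgb := hg.nonneg hb
  rcases le_total b (T * a) with h | h
  · have : 0 ≤ 1 / T * (b * g b) := by positivity
    nlinarith
  · have h1 : a ≤ b / T := by rw [le_div_iff₀ hT0]; linarith
    have h2 : g a ≤ g b / T := (hg.le_of_le ha h1).trans (hg.div_le hb hT)
    have h3 : 0 ≤ T * (a * g a) := by positivity
    have h4 : g a * b ≤ g b / T * b := mul_le_mul_of_nonneg_right h2 hb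
    have h5 : g b / T * b = 1 / T * (b * g b) := by ring
    linarith

theorem CondG.add_le {g : ℝ → ℝ} {pg qg : ℝ} (hg : CondG g pg qg) {a b l : ℝ} (ha : 0 ≤ a)
    (hb : 0 ≤ b) (hl : 1 ≤ l) : g (l * (a + b)) ≤ (2 * l) ^ qg * (g a + g b) := by
  have hC : 0 ≤ (2 * l) ^ qg := by positivity
  have hga := hg.nonneg ha
  have hgb := hg.nonneg hb
  rcases le_total a b with h | h
  · calc g (l * (a + b)) ≤ g ((2 * l) * b) := hg.le_of_le (by positivity) (by nlinarith)
      _ ≤ (2 * l) ^ qg * g b := hg.mul_le hb (by linarith)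
      _ ≤ _ := by nlinarith
  · calc g (l * (a + b)) ≤ g ((2 * l) * a) := hg.le_of_le (by positivity) (by nlinarith)
      _ ≤ (2 * l) ^ qg * g a := hg.mul_le ha (by linarith)
      _ ≤ _ := by nlinarith

/-- Quasi-subadditivity of `t g(t)`. -/
theorem CondG.P_add_le {g : ℝ → ℝ} {pg qg : ℝ} (hg : CondG g pg qg) {a b l x : ℝ} (ha : 0 ≤ a)
    (hb : 0 ≤ b) (hl : 1 ≤ l) (hx0 : 0 ≤ x) (hx : x ≤ a + l * b) :
    x * g x ≤ (2 * l) * (2 * l) ^ qg * (a * g a + b * g b) := by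
  have hC : 0 ≤ (2 * l) ^ qg := by positivity
  have hga := hg.nonneg ha
  have hgb := hg.nonneg hb
  have key : ∀ c, 0 ≤ c → x ≤ 2 * l * c → x * g x ≤ (2 * l) * (2 * l) ^ qg * (c * g c) := by
    intro c hc hxc
    calc x * g x ≤ (2 * l * c) * g (2 * l * c) :=
          mul_le_mul hxc (hg.le_of_le hx0 hxc) (hg.nonneg hx0) (by positivity)
      _ ≤ (2 * l * c) * ((2 * l) ^ qg * g c) :=
          mul_le_mul_of_nonneg_left (hg.mul_le hc (by linarith)) (by positivity)
      _ = _ := by ring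
  have hk : 0 ≤ (2 * l) * (2 * l) ^ qg := by positivity
  have e1 : 0 ≤ a * g a := by positivity
  have e2 : 0 ≤ b * g b := by positivity
  rcases le_total a b with h | h
  · refine (key b hb (by nlinarith)).trans (mul_le_mul_of_nonneg_left (by linarith) hk)
  · refine (key a ha (by nlinarith)).trans (mul_le_mul_of_nonneg_left (by linarith) hk)

/-! ### Abstract convergence lemmas -/

open scoped ENNReal in
theorem conv_lemma {α : Type*} [MeasurableSpace α] {μ : Measure α} {X : ℕ → α → ℝ} {Y : α → ℝ}
    {H : ℕ → α → ℝ≥0∞} {M : ℝ≥0∞} (hM : M ≠ ∞)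
    (hXm : ∀ k, AEStronglyMeasurable (X k) μ) (hY : AEStronglyMeasurable Y μ)
    (hlim : ∀ᵐ a ∂μ, Tendsto (fun k => X k a) atTop (𝓝 (Y a)))
    (hHm : ∀ k, AEMeasurable (H k) μ) (hH : ∀ k, ∫⁻ a, H k a ∂μ ≤ M)
    (hb : ∀ T : ℝ, 1 ≤ T → ∃ F : α → ℝ≥0∞, AEMeasurable F μ ∧ ∫⁻ a, F a ∂μ ≠ ∞ ∧
      ∀ k, ∀ᵐ a ∂μ, ‖X k a‖ₑ ≤ F a + ENNReal.ofReal (1 / T) * H k a) :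
    Integrable Y μ ∧ Tendsto (fun k => ∫ a, X k a ∂μ) atTop (𝓝 (∫ a, Y a ∂μ)) := by
  have hle : ∀ T : ℝ, 1 ≤ T → ∀ F : α → ℝ≥0∞, AEMeasurable F μ → 
      (∀ k, ∀ᵐ a ∂μ, ‖X k a‖ₑ ≤ F a + ENNReal.ofReal (1 / T) * H k a) → 
      ∀ k, ∫⁻ a, ‖X k a‖ₑ ∂μ ≤ ∫⁻ a, F a ∂μ + ENNReal.ofReal (1 / T) * M := by
    intro T hT F hF hk k
    calc ∫⁻ a, ‖X k a‖ₑ ∂μ ≤ ∫⁻ a, (F a + ENNReal.ofReal (1 / T) * H k a) ∂μ :=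
          lintegral_mono_ae (hk k)
      _ = ∫⁻ a, F a ∂μ + ENNReal.ofReal (1 / T) * ∫⁻ a, H k a ∂μ := by
          rw [lintegral_add_left' hF, lintegral_const_mul'' _ (hHm k)]
      _ ≤ _ := by gcongr; exact hH k
  obtain ⟨F1, hF1m, hF1, hF1b⟩ := hb 1 le_rfl
  have hfin : ∫⁻ a, F1 a ∂μ + ENNReal.ofReal (1 / 1) * M < ∞ :=
    ENNReal.add_lt_top.2 ⟨hF1.lt_top, ENNReal.mul_lt_top ENNReal.ofReal_lt_top hM.lt_top⟩
  have hXi : ∀ k, Integrable (X k) μ := fun k =>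
    ⟨hXm k, (hle 1 le_rfl F1 hF1m hF1b k).trans_lt hfin⟩
  have hYi : Integrable Y μ := by
    refine ⟨hY, ?_⟩
    have h1 : ∫⁻ a, ‖Y a‖ₑ ∂μ = ∫⁻ a, liminf (fun k => ‖X k a‖ₑ) atTop ∂μ := by
      apply lintegral_congr_ae
      filter_upwards [hlim] with a ha
      have h2 : Tendsto (fun k => ‖X k a‖ₑ) atTop (𝓝 ‖Y a‖ₑ) :=
        (continuous_enorm.tendsto (Y a)).comp ha
      exact h2.liminf_eq.symm
    rw [HasFiniteIntegral, h1]
    refine (lintegral_liminf_le' (fun k => (hXm k).enorm)).trans_lt ?_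
    refine lt_of_le_of_lt ?_ hfin
    refine liminf_le_of_le (by isBoundedDefault) fun b hb' => ?_
    obtain ⟨k, hk⟩ := hb'.exists
    exact hk.trans (hle 1 le_rfl F1 hF1m hF1b k)
  refine ⟨hYi, tendsto_integral_of_L1 Y hY (Eventually.of_forall hXi) ?_⟩
  rw [ENNReal.tendsto_nhds_zero]
  intro ε hε
  have hε2 : ε / 2 ≠ 0 := by simp [hε.ne']
  obtain ⟨T, hT, hTM⟩ : ∃ T : ℝ, 1 ≤ T ∧ ENNReal.ofReal (1 / T) * M ≤ ε / 2 := by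
    have h0 : Tendsto (fun T : ℝ => ENNReal.ofReal (1 / T) * M) atTop (𝓝 (ENNReal.ofReal 0 * M)) :=
      ENNReal.Tendsto.mul_const (ENNReal.tendsto_ofReal
        (tendsto_const_nhds.div_atTop tendsto_id)) (Or.inr hM)
    rw [ENNReal.ofReal_zero, zero_mul, ENNReal.tendsto_nhds_zero] at h0
    obtain ⟨T, h1, h2⟩ := ((h0 _ (pos_iff_ne_zero.2 hε2)).and (eventually_ge_atTop 1)).exists
    exact ⟨T, h2, h1⟩
  obtain ⟨F, hFm, hF, hFb⟩ := hb T hT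
  have hdct : Tendsto (fun k => ∫⁻ a, (‖X k a - Y a‖ₑ - ENNReal.ofReal (1 / T) * H k a) ∂μ) atTop
      (𝓝 (∫⁻ _, 0 ∂μ)) := by
    apply tendsto_lintegral_of_dominated_convergence' (fun a => F a + ‖Y a‖ₑ)
    · intro k
      exact ((hXm k).sub hY).enorm.sub ((hHm k).const_mul _)
    · intro k
      filter_upwards [hFb k] with a ha
      rw [tsub_le_iff_right]
      calc ‖X k a - Y a‖ₑ ≤ ‖X k a‖ₑ + ‖Y a‖ₑ := enorm_sub_le
        _ ≤ F a + ENNReal.ofReal (1 / T) * H k a + ‖Y a‖ₑ := by gcongr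
        _ = _ := by ring
    · rw [lintegral_add_left' hFm]
      exact (ENNReal.add_lt_top.2 ⟨hF.lt_top, hYi.2⟩).ne
    · filter_upwards [hlim] with a ha
      have h1 : Tendsto (fun k => ‖X k a - Y a‖ₑ) atTop (𝓝 0) := by
        have := (continuous_enorm.tendsto _).comp (ha.sub_const (Y a))
        simpa [Function.comp_def] using this
      exact tendsto_of_tendsto_of_tendsto_of_le_of_le tendsto_const_nhds h1 (fun _ => zero_le)
        (fun k => tsub_le_self)
  rw [lintegral_zero, ENNReal.tendsto_nhds_zero] at hdct
  filter_upwards [hdct _ (pos_iff_ne_zero.2 hε2)] with k hk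
  calc ∫⁻ a, ‖X k a - Y a‖ₑ ∂μ
      ≤ ∫⁻ a, ((‖X k a - Y a‖ₑ - ENNReal.ofReal (1 / T) * H k a) + ENNReal.ofReal (1 / T) * H k a) ∂μ :=
        lintegral_mono fun a => le_tsub_add
    _ = ∫⁻ a, (‖X k a - Y a‖ₑ - ENNReal.ofReal (1 / T) * H k a) ∂μ
          + ENNReal.ofReal (1 / T) * ∫⁻ a, H k a ∂μ := by
        rw [lintegral_add_right' _ ((hHm k).const_mul _), lintegral_const_mul'' _ (hHm k)]
    _ ≤ ε / 2 + ENNReal.ofReal (1 / T) * M := by gcongr; exact hH k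
    _ ≤ ε / 2 + ε / 2 := by gcongr
    _ = ε := ENNReal.add_halves ε

theorem rev_fatou {α : Type*} [MeasurableSpace α] {μ : Measure α} {X : ℕ → α → ℝ} {Y F : α → ℝ}
    {r : ℕ → ℝ} (hr : Tendsto r atTop (𝓝 0))
    (hX : ∀ k, Integrable (X k) μ) (hF : Integrable F μ)
    (hlim : ∀ᵐ a ∂μ, Tendsto (fun k => X k a) atTop (𝓝 (Y a)))
    (hXF : ∀ k, ∀ᵐ a ∂μ, X k a ≤ F a) (hF0 : ∀ a, 0 ≤ F a) (hY : ∀ᵐ a ∂μ, Y a ≤ 0)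
    (hrX : ∀ k, r k ≤ ∫ a, X k a ∂μ) : ∀ᵐ a ∂μ, Y a = 0 := by
  have hYm : AEStronglyMeasurable Y μ := aestronglyMeasurable_of_tendsto_ae atTop (fun k => (hX k).1) hlim
  have h1 : ∫⁻ a, ENNReal.ofReal (F a - Y a) ∂μ ≤ ∫⁻ a, ENNReal.ofReal (F a) ∂μ := by
    have e1 : ∫⁻ a, ENNReal.ofReal (F a - Y a) ∂μ
        = ∫⁻ a, liminf (fun k => ENNReal.ofReal (F a - X k a)) atTop ∂μ := by
      apply lintegral_congr_ae
      filter_upwards [hlim] with a ha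
      exact (ENNReal.tendsto_ofReal (ha.const_sub (F a))).liminf_eq.symm
    rw [e1]
    refine (lintegral_liminf_le' fun k => (hF.sub (hX k)).1.aemeasurable.ennreal_ofReal).trans ?_
    have e2 : ∀ k, ∫⁻ a, ENNReal.ofReal (F a - X k a) ∂μ ≤ ENNReal.ofReal (∫ a, F a ∂μ - r k) := by
      intro k
      have e4 := ofReal_integral_eq_lintegral_ofReal (hF.sub (hX k))
        ((hXF k).mono fun a ha => sub_nonneg.2 ha)
      simp only [Pi.sub_apply] at e4
      rw [← e4]
      apply ENNReal.ofReal_le_ofReal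
      rw [integral_sub hF (hX k)]
      linarith [hrX k]
    have e3 : Tendsto (fun k => ENNReal.ofReal (∫ a, F a ∂μ - r k)) atTop
        (𝓝 (ENNReal.ofReal (∫ a, F a ∂μ))) := by
      apply ENNReal.tendsto_ofReal
      simpa using hr.const_sub (∫ a, F a ∂μ)
    calc _ ≤ liminf (fun k => ENNReal.ofReal (∫ a, F a ∂μ - r k)) atTop :=
          liminf_le_liminf (Eventually.of_forall e2)
      _ = ENNReal.ofReal (∫ a, F a ∂μ) := e3.liminf_eq
      _ = _ := ofReal_integral_eq_lintegral_ofReal hF (Eventually.of_forall hF0)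
  have hfin : ∫⁻ a, ENNReal.ofReal (F a) ∂μ ≠ ⊤ := by
    rw [← ofReal_integral_eq_lintegral_ofReal hF (Eventually.of_forall hF0)]
    exact ENNReal.ofReal_ne_top
  have h2 : (fun a => ENNReal.ofReal (F a)) =ᵐ[μ] fun a => ENNReal.ofReal (F a - Y a) := by
    apply ae_eq_of_ae_le_of_lintegral_le
    · filter_upwards [hY] with a ha
      exact ENNReal.ofReal_le_ofReal (by linarith)
    · exact hfin
    · exact (hF.1.sub hYm).aemeasurable.ennreal_ofReal
    · exact h1
  filter_upwards [h2, hY] with a ha hYa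
  have := (ENNReal.ofReal_eq_ofReal_iff (hF0 a) (by linarith [hF0 a])).1 ha
  linarith
/-! ### The energy integrand -/

/-- The integrand of `energy`. -/
def Xe (n : ℕ) (s : ℝ) (g : ℝ → ℝ) (K : Eucl n → Eucl n → ℝ) (u η : Eucl n → ℝ)
    (p : Eucl n × Eucl n) : ℝ :=
  g ((u p.1 - u p.2) / ‖p.1 - p.2‖ ^ s) * (η p.1 - η p.2) * K p.1 p.2 / ‖p.1 - p.2‖ ^ s

theorem energy_eq (n : ℕ) (s : ℝ) (g : ℝ → ℝ) (K : Eucl n → Eucl n → ℝ) (u η : Eucl n → ℝ) :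
    energy n s g K u η = ∫ p, Xe n s g K u η p := rfl

/-- Difference quotient. -/
def Dq {n : ℕ} (s : ℝ) (ψ : Eucl n → ℝ) (p : Eucl n × Eucl n) : ℝ :=
  |ψ p.1 - ψ p.2| / ‖p.1 - p.2‖ ^ s

/-- Modular density. -/
def PD {n : ℕ} (s : ℝ) (g : ℝ → ℝ) (ψ : Eucl n → ℝ) (p : Eucl n × Eucl n) : ℝ :=
  Dq s ψ p * g (Dq s ψ p) / ‖p.1 - p.2‖ ^ n

/-- Tail density. -/
def Qd {n : ℕ} (s : ℝ) (g : ℝ → ℝ) (u : Eucl n → ℝ) (p : Eucl n × Eucl n) : ℝ :=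
  g (Dq s u p) / ‖p.1 - p.2‖ ^ s / ‖p.1 - p.2‖ ^ n

theorem Dq_nonneg {n : ℕ} (s : ℝ) (ψ : Eucl n → ℝ) (p : Eucl n × Eucl n) : 0 ≤ Dq s ψ p := by
  unfold Dq; positivity

theorem PD_nonneg {n : ℕ} (s : ℝ) {g : ℝ → ℝ} {pg qg : ℝ} (hg : CondG g pg qg)
    (ψ : Eucl n → ℝ) (p : Eucl n × Eucl n) : 0 ≤ PD s g ψ p := by
  have := hg.nonneg (Dq_nonneg s ψ p)
  have := Dq_nonneg s ψ p
  unfold PD; positivity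

theorem Qd_nonneg {n : ℕ} (s : ℝ) {g : ℝ → ℝ} {pg qg : ℝ} (hg : CondG g pg qg)
    (ψ : Eucl n → ℝ) (p : Eucl n × Eucl n) : 0 ≤ Qd s g ψ p := by
  have := hg.nonneg (Dq_nonneg s ψ p)
  unfold Qd; positivity

theorem Dq_meas {n : ℕ} (s : ℝ) {ψ : Eucl n → ℝ} (hψ : Measurable ψ) : Measurable (Dq s ψ) := by
  unfold Dq; fun_prop

theorem PD_meas {n : ℕ} (s : ℝ) {g : ℝ → ℝ} (hg : Continuous g) {ψ : Eucl n → ℝ}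
    (hψ : Measurable ψ) : Measurable (PD s g ψ) := by
  have := Dq_meas s hψ
  have := hg.measurable
  unfold PD; fun_prop

theorem Qd_meas {n : ℕ} (s : ℝ) {g : ℝ → ℝ} (hg : Continuous g) {ψ : Eucl n → ℝ}
    (hψ : Measurable ψ) : Measurable (Qd s g ψ) := by
  have := Dq_meas s hψ
  have := hg.measurable
  unfold Qd; fun_prop

theorem Xe_meas {n : ℕ} {s : ℝ} (hs0 : 0 < s) {g : ℝ → ℝ} (hg : Continuous g)
    {K : Eucl n → Eucl n → ℝ} {lam Lam : ℝ} (hK : CondK n K lam Lam) {u η : Eucl n → ℝ}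
    (hu : Measurable u) (hη : Measurable η) : Measurable (Xe n s g K u η) := by
  let S : Set (Eucl n × Eucl n) := {p | p.1 ≠ p.2}
  have hS : MeasurableSet S := (isOpen_ne_fun continuous_fst continuous_snd).measurableSet
  have hK' : Measurable (S.piecewise (fun p : Eucl n × Eucl n => K p.1 p.2) (fun _ => 0)) :=
    hK.cont.measurable_piecewise continuousOn_const hS
  have hgm := hg.measurable
  have : Xe n s g K u η = fun p => g ((u p.1 - u p.2) / ‖p.1 - p.2‖ ^ s) * (η p.1 - η p.2) *
      (S.piecewise (fun p : Eucl n × Eucl n => K p.1 p.2) (fun _ => 0)) p / ‖p.1 - p.2‖ ^ s := by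
    funext p
    by_cases hp : p ∈ S
    · simp only [Xe, Set.piecewise_eq_of_mem _ _ _ hp]
    · have h : p.1 = p.2 := not_not.1 hp
      simp [Xe, h, Real.zero_rpow hs0.ne']
  rw [this]
  fun_prop

theorem K_nonneg {n : ℕ} {K : Eucl n → Eucl n → ℝ} {lam Lam : ℝ} (hK : CondK n K lam Lam)
    {x y : Eucl n} (h : x ≠ y) : 0 < K x y := by
  have : 0 < ‖x - y‖ := norm_pos_iff.2 (sub_ne_zero.2 h)
  exact lt_of_lt_of_le (div_pos hK.lam_pos (by positivity)) (hK.lower x y h)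

theorem Xe_bound {n : ℕ} {s : ℝ} (hs0 : 0 < s) {g : ℝ → ℝ} {pg qg : ℝ} (hg : CondG g pg qg)
    {K : Eucl n → Eucl n → ℝ} {lam Lam : ℝ} (hK : CondK n K lam Lam) (u η : Eucl n → ℝ)
    (p : Eucl n × Eucl n) :
    |Xe n s g K u η p| ≤ Lam * (Qd s g u p * |η p.1 - η p.2|) := by
  by_cases hp : p.1 = p.2
  · simp [Xe, hp]
  · have hd : 0 < ‖p.1 - p.2‖ := norm_pos_iff.2 (sub_ne_zero.2 hp)
    have hds : 0 < ‖p.1 - p.2‖ ^ s := Real.rpow_pos_of_pos hd s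
    have hK1 := hK.upper _ _ hp
    have hK0 := K_nonneg hK hp
    have hgn := hg.nonneg (Dq_nonneg s u p)
    have e : |g ((u p.1 - u p.2) / ‖p.1 - p.2‖ ^ s)| = g (Dq s u p) := by
      rw [hg.abs_eq, abs_div, abs_of_pos hds]; rfl
    unfold Xe
    rw [abs_div, abs_mul, abs_mul, e, abs_of_pos hds, abs_of_pos hK0]
    calc g (Dq s u p) * |η p.1 - η p.2| * K p.1 p.2 / ‖p.1 - p.2‖ ^ s
        ≤ g (Dq s u p) * |η p.1 - η p.2| * (Lam / ‖p.1 - p.2‖ ^ n) / ‖p.1 - p.2‖ ^ s := by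
          gcongr
      _ = Lam * (Qd s g u p * |η p.1 - η p.2|) := by unfold Qd; field_simp

theorem Qd_mul {n : ℕ} (s : ℝ) (g : ℝ → ℝ) (u : Eucl n → ℝ) (p : Eucl n × Eucl n) (a : ℝ) :
    Qd s g u p * a = g (Dq s u p) * (a / ‖p.1 - p.2‖ ^ s) / ‖p.1 - p.2‖ ^ n := by
  unfold Qd; ring

/-- Far-away integrability. -/
theorem far_integrable {n : ℕ} {s : ℝ} (hs0 : 0 < s) {g : ℝ → ℝ} {pg qg : ℝ}
    (hg : CondG g pg qg) {u : Eucl n → ℝ} (hu : MemLgs n s g u) (x0 : Eucl n) {R : ℝ}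
    (hR : 0 < R) :
    IntegrableOn (Qd s g u) (closedBall x0 (3 * R) ×ˢ (ball x0 (4 * R))ᶜ) := by
  obtain ⟨hum, hui⟩ := hu
  set A : ℝ := 1 + ‖x0‖ + 3 * R with hA
  have hA1 : 1 ≤ A := by have := norm_nonneg x0; linarith
  -- lower bound for the distance
  obtain ⟨κ, hκ0, hκ1, hκ⟩ : ∃ κ : ℝ, 0 < κ ∧ κ ≤ 1 ∧ ∀ x ∈ closedBall x0 (3 * R),
      ∀ y ∈ (ball x0 (4 * R))ᶜ, κ * (1 + ‖x‖) ≤ ‖x - y‖ ∧ κ * (1 + ‖y‖) ≤ ‖x - y‖ := by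
    refine ⟨min 1 (R / (A + R)), lt_min one_pos (by positivity), min_le_left _ _, ?_⟩
    intro x hx y hy
    rw [mem_closedBall, dist_eq_norm] at hx
    rw [mem_compl_iff, mem_ball, not_lt, dist_eq_norm] at hy
    have h1 : R ≤ ‖x - y‖ := by
      have : ‖y - x0‖ ≤ ‖y - x‖ + ‖x - x0‖ := norm_sub_le_norm_sub_add_norm_sub _ _ _
      rw [norm_sub_rev x y]; linarith
    have h2 : 1 + ‖x‖ ≤ A := by
      have : ‖x‖ ≤ ‖x - x0‖ + ‖x0‖ := by simpa using norm_add_le (x - x0) x0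
      linarith
    have h3 : 1 + ‖y‖ ≤ A + ‖x - y‖ := by
      have : ‖y‖ ≤ ‖x‖ + ‖x - y‖ := by simpa using norm_sub_le x (x - y)
      linarith
    have h4 : A ≤ ‖x - y‖ / R * A := by
      have : 1 ≤ ‖x - y‖ / R := by rw [le_div_iff₀ hR]; linarith
      nlinarith
    have h5 : R / (A + R) * (A + ‖x - y‖) ≤ ‖x - y‖ := by
      rw [div_mul_eq_mul_div, div_le_iff₀ (by positivity)]
      nlinarith
    have hk0 : 0 ≤ R / (A + R) := by positivity
    have hm : min 1 (R / (A + R)) ≤ R / (A + R) := min_le_right _ _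
    have := norm_nonneg x
    have := norm_nonneg y
    constructor
    · calc min 1 (R / (A + R)) * (1 + ‖x‖) ≤ R / (A + R) * (A + ‖x - y‖) := by
            apply mul_le_mul hm (by linarith) (by linarith) hk0
        _ ≤ _ := h5
    · calc min 1 (R / (A + R)) * (1 + ‖y‖) ≤ R / (A + R) * (A + ‖x - y‖) := by
            apply mul_le_mul hm (by linarith) (by linarith) hk0
        _ ≤ _ := h5
  set l : ℝ := (κ ^ s)⁻¹ with hl
  have hκs : 0 < κ ^ s := Real.rpow_pos_of_pos hκ0 s
  have hl1 : 1 ≤ l := (one_le_inv₀ hκs).2 (Real.rpow_le_one hκ0.le hκ1 hs0.le)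
  set C : ℝ := (2 * l) ^ qg with hC
  have hC0 : 0 ≤ C := by positivity
  let a : Eucl n → ℝ := fun x => |u x| / (1 + ‖x‖) ^ s
  have ha0 : ∀ x, 0 ≤ a x := fun x => by positivity
  have ham : Measurable a := by fun_prop
  have hgm := hg.continuous.measurable
  let B : Set (Eucl n) := closedBall x0 (3 * R)
  have hBm : MeasurableSet B := measurableSet_closedBall
  let w : Eucl n → ℝ := fun y => (1 + ‖y‖) ^ (-((n : ℝ) + s))
  have hw : Integrable w := integrable_one_add_norm (by simp [hs0])
  have hgw : Integrable (fun y => g (a y) * w y) := by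
    refine hui.congr (Eventually.of_forall fun y => ?_)
    simp only [a, w]
    rw [Real.rpow_neg (by positivity)]; rfl
  have hgB : Integrable (B.indicator fun x => g (a x)) := by
    have : IntegrableOn (fun x => A ^ ((n : ℝ) + s) * (g (a x) * w x)) B :=
      (hgw.const_mul _).integrableOn
    rw [integrable_indicator_iff hBm]
    refine this.mono' (hgm.comp ham).aestronglyMeasurable ?_
    refine (ae_restrict_iff' hBm).2 (Eventually.of_forall fun x hx => ?_)
    rw [Real.norm_of_nonneg (hg.nonneg (ha0 x))]
    have hx' : 1 + ‖x‖ ≤ A := by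
      have h1 : ‖x - x0‖ ≤ 3 * R := by rw [← dist_eq_norm]; exact hx
      have : ‖x‖ ≤ ‖x - x0‖ + ‖x0‖ := by simpa using norm_add_le (x - x0) x0
      linarith
    have h2 : 1 ≤ A ^ ((n : ℝ) + s) * w x := by
      simp only [w]
      rw [Real.rpow_neg (by positivity), ← div_eq_mul_inv, le_div_iff₀ (by positivity), one_mul]
      exact Real.rpow_le_rpow (by positivity) hx' (by positivity)
    have := hg.nonneg (ha0 x)
    calc g (a x) = g (a x) * 1 := by ring
      _ ≤ g (a x) * (A ^ ((n : ℝ) + s) * w x) := by gcongr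
      _ = _ := by ring
  have hone : Integrable (B.indicator fun _ => (1:ℝ)) := by
    rw [integrable_indicator_iff hBm]
    exact integrableOn_const (isCompact_closedBall _ _).measure_lt_top.ne
  have hdom : Integrable (fun p : Eucl n × Eucl n => (κ ^ ((n : ℝ) + s))⁻¹ * C *
      ((B.indicator fun x => g (a x)) p.1 * w p.2 +
        (B.indicator fun _ => (1:ℝ)) p.1 * (g (a p.2) * w p.2))) :=
    ((hgB.mul_prod hw).add (hone.mul_prod hgw)).const_mul _
  refine hdom.integrableOn.mono' (Qd_meas s hg.continuous hum).aestronglyMeasurable ?_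
  refine (ae_restrict_iff' (hBm.prod measurableSet_ball.compl)).2
    (Eventually.of_forall fun p hp => ?_)
  obtain ⟨h1, h2⟩ := hκ p.1 hp.1 p.2 hp.2
  have hx1 : 0 < 1 + ‖p.1‖ := by positivity
  have hy1 : 0 < 1 + ‖p.2‖ := by positivity
  have hd : 0 < ‖p.1 - p.2‖ := lt_of_lt_of_le (by positivity) h1
  have hpB : p.1 ∈ B := hp.1
  rw [Real.norm_of_nonneg (Qd_nonneg s hg u p), indicator_of_mem hpB, indicator_of_mem hpB, one_mul]
  have hq : ∀ z : Eucl n, κ * (1 + ‖z‖) ≤ ‖p.1 - p.2‖ → |u z| / ‖p.1 - p.2‖ ^ s ≤ l * a z := by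
    intro z hz
    have : (κ * (1 + ‖z‖)) ^ s ≤ ‖p.1 - p.2‖ ^ s := Real.rpow_le_rpow (by positivity) hz hs0.le
    rw [Real.mul_rpow hκ0.le (by positivity)] at this
    have h0 : 0 < (1 + ‖z‖) ^ s := Real.rpow_pos_of_pos (by positivity) _
    calc |u z| / ‖p.1 - p.2‖ ^ s ≤ |u z| / (κ ^ s * (1 + ‖z‖) ^ s) := by gcongr
      _ = l * a z := by simp only [hl, a]; field_simp
  have hDq : Dq s u p ≤ l * (a p.1 + a p.2) := by
    calc Dq s u p ≤ (|u p.1| + |u p.2|) / ‖p.1 - p.2‖ ^ s := by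
          unfold Dq; gcongr; exact abs_sub _ _
      _ = |u p.1| / ‖p.1 - p.2‖ ^ s + |u p.2| / ‖p.1 - p.2‖ ^ s := by ring
      _ ≤ l * a p.1 + l * a p.2 := add_le_add (hq _ h1) (hq _ h2)
      _ = _ := by ring
  have hgD : g (Dq s u p) ≤ C * (g (a p.1) + g (a p.2)) :=
    (hg.le_of_le (Dq_nonneg s u p) hDq).trans (hg.add_le (ha0 _) (ha0 _) hl1)
  have hds : (κ * (1 + ‖p.2‖)) ^ ((n : ℝ) + s) ≤ ‖p.1 - p.2‖ ^ s * ‖p.1 - p.2‖ ^ n := by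
    rw [← Real.rpow_natCast ‖p.1 - p.2‖ n, ← Real.rpow_add hd, add_comm s]
    exact Real.rpow_le_rpow (by positivity) h2 (by positivity)
  rw [Real.mul_rpow hκ0.le hy1.le] at hds
  have hga1 := hg.nonneg (ha0 p.1)
  have hga2 := hg.nonneg (ha0 p.2)
  have hk2 : 0 < κ ^ ((n : ℝ) + s) := Real.rpow_pos_of_pos hκ0 _
  have hk3 : 0 < (1 + ‖p.2‖) ^ ((n : ℝ) + s) := Real.rpow_pos_of_pos hy1 _
  calc Qd s g u p = g (Dq s u p) / (‖p.1 - p.2‖ ^ s * ‖p.1 - p.2‖ ^ n) := by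
        unfold Qd; rw [div_div]
    _ ≤ C * (g (a p.1) + g (a p.2)) / (κ ^ ((n : ℝ) + s) * (1 + ‖p.2‖) ^ ((n : ℝ) + s)) := by
        gcongr
    _ = _ := by
        simp only [w]
        rw [Real.rpow_neg hy1.le]
        field_simp

/-- Local integrability of the modular density of `u`. -/
theorem near_integrable_u {n : ℕ} {s : ℝ} {g : ℝ → ℝ} {pg qg : ℝ}
    (hg : CondG g pg qg) {u : Eucl n → ℝ} {U B : Set (Eucl n)} (hu : MemWsG n s g u U)
    (hB : B ⊆ U) : IntegrableOn (PD s g u) (B ×ˢ B) := by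
  obtain ⟨hum, -, hi⟩ := hu
  have hi := (hi.mono_set (prod_mono hB hB)).const_mul (qg + 1)
  refine hi.mono' (PD_meas s hg.continuous hum).aestronglyMeasurable (Eventually.of_forall ?_)
  intro p
  rw [Real.norm_of_nonneg (PD_nonneg s hg u p)]
  have := hg.le_GG (Dq_nonneg s u p)
  unfold PD
  rw [← mul_div_assoc]
  exact div_le_div_of_nonneg_right this (by positivity)

/-- Local integrability of the modular density of a Lipschitz function. -/
theorem near_integrable_lip {n : ℕ} (hn : 1 ≤ n) {s : ℝ} (hs0 : 0 < s) (hs1 : s < 1) {g : ℝ → ℝ}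
    {pg qg : ℝ} (hg : CondG g pg qg) {ψ : Eucl n → ℝ} {L : ℝ} (hL0 : 0 ≤ L)
    (hψ : Measurable ψ) (hL : ∀ x y, |ψ x - ψ y| ≤ L * ‖x - y‖)
    (x0 : Eucl n) (r : ℝ) : IntegrableOn (PD s g ψ) (ball x0 r ×ˢ ball x0 r) := by
  set C : ℝ := L * g (L * (2 * r) ^ (1 - s)) with hC
  let k : Eucl n → ℝ := (ball (0 : Eucl n) (2 * r)).indicator fun z => C * ‖z‖ ^ (-((n : ℝ) - (1 - s)))
  have hk : Integrable k := by
    rw [integrable_indicator_iff measurableSet_ball]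
    refine integrableOn_ball_of_norm_le_rpow (C := |C|) (α := (n : ℝ) - (1 - s)) ?_ ?_ ?_ ?_
    · simpa using hn
    · simp [hs1]
    · refine Eventually.of_forall fun z => ?_
      rw [norm_mul, Real.norm_eq_abs, Real.norm_of_nonneg (by positivity)]
    · exact (by fun_prop : Measurable fun z : Eucl n =>
        C * ‖z‖ ^ (-((n : ℝ) - (1 - s)))).aestronglyMeasurable
  have hone : Integrable ((ball x0 r).indicator fun _ => (1:ℝ)) := by
    rw [integrable_indicator_iff measurableSet_ball]
    exact integrableOn_const measure_ball_lt_top.ne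
  have hdom := hone.convolution_integrand (ContinuousLinearMap.mul ℝ ℝ) hk
  refine hdom.integrableOn.mono' (PD_meas s hg.continuous hψ).aestronglyMeasurable ?_
  refine (ae_restrict_iff' (measurableSet_ball.prod measurableSet_ball)).2
    (Eventually.of_forall fun p hp => ?_)
  rw [Real.norm_of_nonneg (PD_nonneg s hg ψ p)]
  have hd2 : ‖p.1 - p.2‖ < 2 * r := by
    have h1 : ‖p.1 - x0‖ < r := by rw [← dist_eq_norm]; exact hp.1
    have h2 : ‖x0 - p.2‖ < r := by rw [norm_sub_rev, ← dist_eq_norm]; exact hp.2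
    have := norm_sub_le_norm_sub_add_norm_sub p.1 x0 p.2
    linarith
  have hmem : p.1 - p.2 ∈ ball (0 : Eucl n) (2 * r) := by simpa using hd2
  simp only [ContinuousLinearMap.mul_apply', k]
  rw [indicator_of_mem hp.2, indicator_of_mem hmem, one_mul]
  by_cases hp0 : p.1 = p.2
  · have hz : PD s g ψ p = 0 := by simp [PD, Dq, hp0]
    have hr : 0 ≤ 2 * r := (norm_nonneg _).trans hd2.le
    rw [hz]
    have : 0 ≤ C := mul_nonneg hL0 (hg.nonneg (by positivity))
    positivity
  · have hd : 0 < ‖p.1 - p.2‖ := norm_pos_iff.2 (sub_ne_zero.2 hp0)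
    have hr : 0 < 2 * r := hd.trans hd2
    have hDq : Dq s ψ p ≤ L * ‖p.1 - p.2‖ ^ (1 - s) := by
      unfold Dq
      rw [Real.rpow_sub hd, Real.rpow_one, ← mul_div_assoc]
      gcongr
      exact hL _ _
    have h2 : L * ‖p.1 - p.2‖ ^ (1 - s) ≤ L * (2 * r) ^ (1 - s) := by
      gcongr
    have h3 : g (Dq s ψ p) ≤ g (L * (2 * r) ^ (1 - s)) :=
      hg.le_of_le (Dq_nonneg s ψ p) (hDq.trans h2)
    calc PD s g ψ p ≤ L * ‖p.1 - p.2‖ ^ (1 - s) * g (L * (2 * r) ^ (1 - s)) / ‖p.1 - p.2‖ ^ n := by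
          unfold PD
          have := hg.nonneg (Dq_nonneg s ψ p)
          gcongr
      _ = C * ‖p.1 - p.2‖ ^ (-((n : ℝ) - (1 - s))) := by
          have : -((n : ℝ) - (1 - s)) = (1 - s) - n := by ring
          rw [this, Real.rpow_sub hd (1 - s) n, Real.rpow_natCast, hC]; ring
/-! ### Domination and convergence of the energy -/

/-- The tail part of the dominating function. -/
def Far {n : ℕ} (s : ℝ) (g : ℝ → ℝ) (u : Eucl n → ℝ) (x0 : Eucl n) (R : ℝ)
    (p : Eucl n × Eucl n) : ℝ :=
  (closedBall x0 (3 * R) ×ˢ (ball x0 (4 * R))ᶜ).indicator (Qd s g u) p +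
  ((ball x0 (4 * R))ᶜ ×ˢ closedBall x0 (3 * R)).indicator (Qd s g u) p

theorem Far_nonneg {n : ℕ} (s : ℝ) {g : ℝ → ℝ} {pg qg : ℝ} (hg : CondG g pg qg)
    (u : Eucl n → ℝ) (x0 : Eucl n) (R : ℝ) (p : Eucl n × Eucl n) : 0 ≤ Far s g u x0 R p :=
  add_nonneg (indicator_nonneg (fun q _ => Qd_nonneg s hg u q) p)
    (indicator_nonneg (fun q _ => Qd_nonneg s hg u q) p)

theorem Far_integrable {n : ℕ} {s : ℝ} (hs0 : 0 < s) {g : ℝ → ℝ} {pg qg : ℝ}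
    (hg : CondG g pg qg) {u : Eucl n → ℝ} (hu : MemLgs n s g u) (x0 : Eucl n) {R : ℝ}
    (hR : 0 < R) : Integrable (Far s g u x0 R) := by
  have h1 := far_integrable hs0 hg hu x0 hR
  have h2 : IntegrableOn (Qd s g u) ((ball x0 (4 * R))ᶜ ×ˢ closedBall x0 (3 * R)) := by
    have h3 := IntegrableOn.swap (μ := (volume : Measure (Eucl n)))
      (ν := (volume : Measure (Eucl n))) h1
    have h4 : (Qd s g u) ∘ Prod.swap = Qd s g u := by
      funext p
      simp only [Function.comp, Qd, Dq, Prod.fst_swap, Prod.snd_swap, norm_sub_rev p.2 p.1,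
        abs_sub_comm (u p.2) (u p.1)]
    rw [h4] at h3
    exact h3
  exact (h1.integrable_indicator (measurableSet_closedBall.prod measurableSet_ball.compl)).add
    (h2.integrable_indicator (measurableSet_ball.compl.prod measurableSet_closedBall))

theorem Xe_far {n : ℕ} {s : ℝ} (hs0 : 0 < s) {g : ℝ → ℝ} {pg qg : ℝ} (hg : CondG g pg qg)
    {K : Eucl n → Eucl n → ℝ} {lam Lam : ℝ} (hK : CondK n K lam Lam) (u : Eucl n → ℝ)
    {ψ : Eucl n → ℝ} {x0 : Eucl n} {R : ℝ} (hR : 0 < R) (h0 : ∀ x, 0 ≤ ψ x) (h1 : ∀ x, ψ x ≤ 1)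
    (hsupp : ∀ x, x ∉ closedBall x0 (3 * R) → ψ x = 0) {p : Eucl n × Eucl n}
    (hp : p ∉ ball x0 (4 * R) ×ˢ ball x0 (4 * R)) :
    |Xe n s g K u ψ p| ≤ Lam * Far s g u x0 R p := by
  have hLam : 0 ≤ Lam := (hK.lam_pos.trans_le hK.lam_le_Lam).le
  refine (Xe_bound hs0 hg hK u ψ p).trans (mul_le_mul_of_nonneg_left ?_ hLam)
  have hQ := Qd_nonneg s hg u p
  have hi1 : 0 ≤ (closedBall x0 (3 * R) ×ˢ (ball x0 (4 * R))ᶜ).indicator (Qd s g u) p :=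
    indicator_nonneg (fun q _ => Qd_nonneg s hg u q) p
  have hi2 : 0 ≤ ((ball x0 (4 * R))ᶜ ×ˢ closedBall x0 (3 * R)).indicator (Qd s g u) p :=
    indicator_nonneg (fun q _ => Qd_nonneg s hg u q) p
  have hd : |ψ p.1 - ψ p.2| ≤ 1 := by
    rw [abs_le]; constructor <;> linarith [h0 p.1, h0 p.2, h1 p.1, h1 p.2]
  have hsub : closedBall x0 (3 * R) ⊆ ball x0 (4 * R) := closedBall_subset_ball (by linarith)
  have hQ1 : Qd s g u p * |ψ p.1 - ψ p.2| ≤ Qd s g u p := by nlinarith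
  unfold Far
  by_cases hx : p.1 ∈ closedBall x0 (3 * R)
  · have hy : p.2 ∈ (ball x0 (4 * R))ᶜ := fun h => hp ⟨hsub hx, h⟩
    have hm : p ∈ closedBall x0 (3 * R) ×ˢ (ball x0 (4 * R))ᶜ := ⟨hx, hy⟩
    rw [indicator_of_mem hm] at hi1 ⊢
    linarith
  · by_cases hy : p.2 ∈ closedBall x0 (3 * R)
    · have hx' : p.1 ∈ (ball x0 (4 * R))ᶜ := fun h => hp ⟨h, hsub hy⟩
      have hm : p ∈ (ball x0 (4 * R))ᶜ ×ˢ closedBall x0 (3 * R) := ⟨hx', hy⟩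
      rw [indicator_of_mem hm] at hi2 ⊢
      linarith
    · rw [hsupp _ hx, hsupp _ hy]
      simp only [sub_self, abs_zero, mul_zero]
      linarith

theorem Qd_young {n : ℕ} (s : ℝ) {g : ℝ → ℝ} {pg qg : ℝ} (hg : CondG g pg qg)
    (u ψ : Eucl n → ℝ) (p q : Eucl n × Eucl n) (hpq : p.1 - p.2 = q.1 - q.2) {T : ℝ} (hT : 1 ≤ T) :
    Qd s g u p * |ψ q.1 - ψ q.2| ≤ T * PD s g u p + 1 / T * PD s g ψ q := by
  rw [Qd_mul]
  have h := hg.young (Dq_nonneg s u p) (Dq_nonneg s ψ q) hT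
  have e : |ψ q.1 - ψ q.2| / ‖p.1 - p.2‖ ^ s = Dq s ψ q := by rw [hpq]; rfl
  rw [e]
  calc g (Dq s u p) * Dq s ψ q / ‖p.1 - p.2‖ ^ n
      ≤ (T * (Dq s u p * g (Dq s u p)) + 1 / T * (Dq s ψ q * g (Dq s ψ q))) / ‖p.1 - p.2‖ ^ n :=
        div_le_div_of_nonneg_right h (by positivity)
    _ = _ := by
        unfold PD
        rw [← hpq]; ring

theorem Xe_integrable_lip {n : ℕ} (hn : 1 ≤ n) {s : ℝ} (hs0 : 0 < s) (hs1 : s < 1) {g : ℝ → ℝ}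
    {pg qg : ℝ} (hg : CondG g pg qg)
    {K : Eucl n → Eucl n → ℝ} {lam Lam : ℝ} (hK : CondK n K lam Lam) {u : Eucl n → ℝ}
    {U : Set (Eucl n)} {x0 : Eucl n} {R : ℝ} (hR : 0 < R) (hU : ball x0 (5 * R) ⊆ U)
    (hW : MemWsG n s g u U) (hLg : MemLgs n s g u)
    {ψ : Eucl n → ℝ} (hψ : Measurable ψ) (h0 : ∀ x, 0 ≤ ψ x) (h1 : ∀ x, ψ x ≤ 1)
    (hsupp : ∀ x, x ∉ closedBall x0 (3 * R) → ψ x = 0) {L : ℝ} (hL0 : 0 ≤ L)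
    (hL : ∀ x y, |ψ x - ψ y| ≤ L * ‖x - y‖) : Integrable (Xe n s g K u ψ) := by
  have hLam : 0 ≤ Lam := (hK.lam_pos.trans_le hK.lam_le_Lam).le
  have hBm : MeasurableSet (ball x0 (4 * R) ×ˢ ball x0 (4 * R)) :=
    measurableSet_ball.prod measurableSet_ball
  have hsub : ball x0 (4 * R) ⊆ ball x0 (5 * R) := ball_subset_ball (by linarith)
  have hi1 := (near_integrable_u hg hW (hsub.trans hU)).integrable_indicator hBm
  have hi2 := (near_integrable_lip hn hs0 hs1 hg hL0 hψ hL x0 (4 * R)).integrable_indicator hBm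
  have hi3 := Far_integrable hs0 hg hLg x0 hR
  refine (((hi1.add hi2).add hi3).const_mul Lam).mono'
    (Xe_meas hs0 hg.continuous hK hLg.1 hψ).aestronglyMeasurable (Eventually.of_forall fun p => ?_)
  rw [Real.norm_eq_abs]
  simp only [Pi.add_apply]
  have hF := Far_nonneg s hg u x0 R p
  by_cases hp : p ∈ ball x0 (4 * R) ×ˢ ball x0 (4 * R)
  · rw [indicator_of_mem hp, indicator_of_mem hp]
    refine (Xe_bound hs0 hg hK u ψ p).trans (mul_le_mul_of_nonneg_left ?_ hLam)
    have := Qd_young s hg u ψ p p rfl (le_refl (1:ℝ))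
    linarith
  · rw [indicator_of_notMem hp, indicator_of_notMem hp, zero_add, zero_add]
    exact Xe_far hs0 hg hK u hR h0 h1 hsupp hp

open scoped ENNReal in
theorem moll_diff {n : ℕ} {ρ φ : Eucl n → ℝ} (hρ0 : ∀ z, 0 ≤ ρ z) (hρ : Integrable ρ)
    (hφm : Measurable φ) (h0 : ∀ x, 0 ≤ φ x) (h1 : ∀ x, φ x ≤ 1) {c : ℝ} (hc : 0 ≤ c)
    (x y : Eucl n) :
    ENNReal.ofReal (c * |(∫ z, ρ z * φ (x - z)) - ∫ z, ρ z * φ (y - z)|) ≤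
      ∫⁻ z, ENNReal.ofReal (ρ z) * ENNReal.ofReal (c * |φ (x - z) - φ (y - z)|) := by
  have hmolint : ∀ w : Eucl n, Integrable fun z => ρ z * φ (w - z) := by
    intro w
    refine hρ.mono' (hρ.1.mul (hφm.comp (measurable_const.sub measurable_id)).aestronglyMeasurable)
      (Eventually.of_forall fun z => ?_)
    rw [norm_mul, Real.norm_of_nonneg (hρ0 z), Real.norm_of_nonneg (h0 _)]
    exact mul_le_of_le_one_right (hρ0 z) (h1 _)
  rw [← integral_sub (hmolint x) (hmolint y)]
  have e : c * |∫ z, (ρ z * φ (x - z) - ρ z * φ (y - z))|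
      = ‖∫ z, c * (ρ z * φ (x - z) - ρ z * φ (y - z))‖ := by
    rw [integral_const_mul, norm_mul, Real.norm_of_nonneg hc, Real.norm_eq_abs]
  rw [e, ofReal_norm]
  refine (enorm_integral_le_lintegral_enorm _).trans (lintegral_mono fun z => ?_)
  rw [← ENNReal.ofReal_mul (hρ0 z), ← ofReal_norm]
  apply ENNReal.ofReal_le_ofReal
  rw [← mul_sub, norm_mul, norm_mul, Real.norm_of_nonneg hc, Real.norm_of_nonneg (hρ0 z),
    Real.norm_eq_abs]
  apply le_of_eq; ring

open scoped ENNReal in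
theorem Xe_moll_bound {n : ℕ} {s : ℝ} (hs0 : 0 < s) {g : ℝ → ℝ}
    {pg qg : ℝ} (hg : CondG g pg qg)
    {K : Eucl n → Eucl n → ℝ} {lam Lam : ℝ} (hK : CondK n K lam Lam) {u : Eucl n → ℝ}
    {x0 : Eucl n} {R : ℝ} (hR : 0 < R)
    {ρ φ : Eucl n → ℝ} (hρ0 : ∀ z, 0 ≤ ρ z) (hρ : Integrable ρ) (hρ1 : ∫ z, ρ z = 1)
    (hρR : ∀ z, ρ z ≠ 0 → ‖z‖ < R)
    (hφm : Measurable φ) (h0 : ∀ x, 0 ≤ φ x) (h1 : ∀ x, φ x ≤ 1)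
    (hk0 : ∀ x, 0 ≤ ∫ z, ρ z * φ (x - z)) (hk1 : ∀ x, ∫ z, ρ z * φ (x - z) ≤ 1)
    (hsupp : ∀ x, x ∉ closedBall x0 (3 * R) → ∫ z, ρ z * φ (x - z) = 0) {T : ℝ} (hT : 1 ≤ T)
    (p : Eucl n × Eucl n) :
    ‖Xe n s g K u (fun x => ∫ z, ρ z * φ (x - z)) p‖ₑ ≤
      ENNReal.ofReal (Lam * (T * (ball x0 (4 * R) ×ˢ ball x0 (4 * R)).indicator (PD s g u) p +
        Far s g u x0 R p)) +
      ENNReal.ofReal (1 / T) * ∫⁻ z, ENNReal.ofReal (ρ z) *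
        ENNReal.ofReal (Lam * (ball x0 (5 * R) ×ˢ ball x0 (5 * R)).indicator (PD s g φ)
          (p - (z, z))) := by
  have hLam : 0 ≤ Lam := (hK.lam_pos.trans_le hK.lam_le_Lam).le
  have hT0 : 0 < T := by linarith
  have hF := Far_nonneg s hg u x0 R p
  rw [← ofReal_norm, Real.norm_eq_abs]
  by_cases hp : p ∈ ball x0 (4 * R) ×ˢ ball x0 (4 * R)
  · have hρl : ∫⁻ z, ENNReal.ofReal (ρ z) = 1 := by
      rw [← ofReal_integral_eq_lintegral_ofReal hρ (Eventually.of_forall hρ0), hρ1,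
        ENNReal.ofReal_one]
    have hQ := Qd_nonneg s hg u p
    have hP := PD_nonneg s hg u p
    have hc : 0 ≤ Lam * Qd s g u p := mul_nonneg hLam hQ
    have hTP : 0 ≤ Lam * (T * PD s g u p) := by positivity
    have step1 : ENNReal.ofReal |Xe n s g K u (fun x => ∫ z, ρ z * φ (x - z)) p| ≤
        ∫⁻ z, ENNReal.ofReal (ρ z) *
          ENNReal.ofReal (Lam * Qd s g u p * |φ (p.1 - z) - φ (p.2 - z)|) := by
      refine le_trans (ENNReal.ofReal_le_ofReal ?_) (moll_diff hρ0 hρ hφm h0 h1 hc p.1 p.2)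
      have := Xe_bound hs0 hg hK u (fun x => ∫ z, ρ z * φ (x - z)) p
      linarith
    refine step1.trans ?_
    have step2 : ∀ z, ENNReal.ofReal (ρ z) *
          ENNReal.ofReal (Lam * Qd s g u p * |φ (p.1 - z) - φ (p.2 - z)|) ≤
        ENNReal.ofReal (Lam * (T * PD s g u p)) * ENNReal.ofReal (ρ z) +
        ENNReal.ofReal (1 / T) * (ENNReal.ofReal (ρ z) *
        ENNReal.ofReal (Lam * (ball x0 (5 * R) ×ˢ ball x0 (5 * R)).indicator (PD s g φ)
          (p - (z, z)))) := by
      intro z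
      by_cases hz : ρ z = 0
      · simp [hz]
      · have hzR := hρR z hz
        have hmem : ∀ x ∈ ball x0 (4 * R), x - z ∈ ball x0 (5 * R) := by
          intro x hx
          rw [mem_ball, dist_eq_norm] at hx ⊢
          have : ‖x - z - x0‖ ≤ ‖x - x0‖ + ‖z‖ := by
            have e : x - z - x0 = (x - x0) - z := by abel
            rw [e]; exact norm_sub_le _ _
          linarith
        have hm : p - (z, z) ∈ ball x0 (5 * R) ×ˢ ball x0 (5 * R) := ⟨hmem _ hp.1, hmem _ hp.2⟩
        rw [indicator_of_mem hm]
        have hy := Qd_young s hg u φ p (p - (z, z)) (by simp) hT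
        simp only [Prod.fst_sub, Prod.snd_sub] at hy
        have hPφ := PD_nonneg s hg φ (p - (z, z))
        have h1T : 0 ≤ 1 / T := by positivity
        rw [mul_comm (ENNReal.ofReal (Lam * (T * PD s g u p))),
          mul_left_comm (ENNReal.ofReal (1 / T)) (ENNReal.ofReal (ρ z)), ← mul_add,
          ← ENNReal.ofReal_mul h1T, ← ENNReal.ofReal_add hTP (by positivity)]
        gcongr
        calc Lam * Qd s g u p * |φ (p.1 - z) - φ (p.2 - z)|
            = Lam * (Qd s g u p * |φ (p.1 - z) - φ (p.2 - z)|) := by ring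
          _ ≤ Lam * (T * PD s g u p + 1 / T * PD s g φ (p - (z, z))) :=
              mul_le_mul_of_nonneg_left hy hLam
          _ = _ := by ring
    refine (lintegral_mono step2).trans ?_
    rw [lintegral_add_left' (hρ.1.aemeasurable.ennreal_ofReal.const_mul _),
      lintegral_const_mul' _ _ ENNReal.ofReal_ne_top, hρl, mul_one,
      lintegral_const_mul' _ _ ENNReal.ofReal_ne_top, indicator_of_mem hp]
    gcongr
    linarith
  · refine le_trans (ENNReal.ofReal_le_ofReal ?_) le_self_add
    rw [indicator_of_notMem hp, mul_zero, zero_add]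
    exact Xe_far hs0 hg hK u hR hk0 hk1 hsupp hp

open scoped ENNReal in
theorem lintegral_moll {n : ℕ} {ρ : Eucl n → ℝ} (hρm : Measurable ρ) (hρ0 : ∀ z, 0 ≤ ρ z)
    (hρ : Integrable ρ) (hρ1 : ∫ z, ρ z = 1) {H : Eucl n × Eucl n → ℝ≥0∞} (hH : Measurable H) :
    Measurable (fun p => ∫⁻ z, ENNReal.ofReal (ρ z) * H (p - (z, z))) ∧
    ∫⁻ p, ∫⁻ z, ENNReal.ofReal (ρ z) * H (p - (z, z)) = ∫⁻ p, H p := by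
  have hm : Measurable (fun q : (Eucl n × Eucl n) × Eucl n =>
      ENNReal.ofReal (ρ q.2) * H (q.1 - (q.2, q.2))) := by fun_prop
  refine ⟨hm.lintegral_prod_right', ?_⟩
  rw [lintegral_lintegral_swap hm.aemeasurable]
  have hρl : ∫⁻ z, ENNReal.ofReal (ρ z) = 1 := by
    rw [← ofReal_integral_eq_lintegral_ofReal hρ (Eventually.of_forall hρ0), hρ1,
      ENNReal.ofReal_one]
  calc ∫⁻ z, ∫⁻ p, ENNReal.ofReal (ρ z) * H (p - (z, z))
      = ∫⁻ z, ENNReal.ofReal (ρ z) * ∫⁻ p, H p := by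
        apply lintegral_congr; intro z
        rw [lintegral_const_mul' _ _ ENNReal.ofReal_ne_top]
        congr 1
        have hi : (volume : Measure (Eucl n × Eucl n)).IsAddRightInvariant := by
          rw [Measure.volume_eq_prod]
          have hl : (Measure.prod (volume : Measure (Eucl n))
            (volume : Measure (Eucl n))).IsAddLeftInvariant := inferInstance
          infer_instance
        exact lintegral_sub_right_eq_self H (z, z)
    _ = ∫⁻ p, H p := by
        rw [lintegral_mul_const'' _ hρ.1.aemeasurable.ennreal_ofReal, hρl, one_mul]

/-- Mollification of a bounded compactly supported function of finite energy. -/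
theorem mollify_energy {n : ℕ} (hn : 1 ≤ n) {s : ℝ} (hs0 : 0 < s) (hs1 : s < 1) {g : ℝ → ℝ}
    {pg qg : ℝ} (hg : CondG g pg qg)
    {K : Eucl n → Eucl n → ℝ} {lam Lam : ℝ} (hK : CondK n K lam Lam) {u : Eucl n → ℝ}
    {U : Set (Eucl n)} {x0 : Eucl n} {R : ℝ} (hR : 0 < R) (hU : ball x0 (5 * R) ⊆ U)
    (hW : MemWsG n s g u U) (hLg : MemLgs n s g u)
    {φ η : Eucl n → ℝ} (hφ : Measurable φ) (h0 : ∀ x, 0 ≤ φ x) (h1 : ∀ x, φ x ≤ 1)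
    (hsupp : ∀ x, x ∉ closedBall x0 R → φ x = 0) (hη : Measurable η) {L l : ℝ} (hL0 : 0 ≤ L)
    (hL : ∀ x y, |η x - η y| ≤ L * ‖x - y‖) (hl : 1 ≤ l)
    (hφη : ∀ x y, |φ x - φ y| ≤ |η x - η y| + l * |u x - u y|) :
    Integrable (Xe n s g K u φ) ∧ ∃ φk : ℕ → Eucl n → ℝ,
      (∀ k, ContDiff ℝ (⊤ : ℕ∞) (φk k)) ∧ (∀ k x, 0 ≤ φk k x) ∧ (∀ k x, φk k x ≤ 1) ∧
      (∀ k x, x ∉ closedBall x0 (2 * R) → φk k x = 0) ∧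
      (∀ᵐ x, Tendsto (fun k => φk k x) atTop (𝓝 (φ x))) ∧
      Tendsto (fun k => ∫ p, Xe n s g K u (φk k) p) atTop (𝓝 (∫ p, Xe n s g K u φ p)) := by
  have hLam : 0 ≤ Lam := (hK.lam_pos.trans_le hK.lam_le_Lam).le
  have hφi : Integrable φ := by
    have hone : Integrable ((closedBall x0 R).indicator fun _ => (1:ℝ)) := by
      rw [integrable_indicator_iff measurableSet_closedBall]
      exact integrableOn_const (isCompact_closedBall _ _).measure_lt_top.ne
    refine hone.mono' hφ.aestronglyMeasurable (Eventually.of_forall fun x => ?_)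
    rw [Real.norm_of_nonneg (h0 x)]
    by_cases hx : x ∈ closedBall x0 R
    · rw [indicator_of_mem hx]; exact h1 x
    · rw [indicator_of_notMem hx, hsupp x hx]
  -- the mollifiers
  let b : ℕ → ContDiffBump (0 : Eucl n) := fun k =>
    ⟨R / (k + 2) / 2, R / (k + 2), by positivity, by
      have : 0 < R / (k + 2) := by positivity
      linarith⟩
  have hbR : ∀ k, (b k).rOut < R := by
    intro k
    change R / ((k:ℝ) + 2) < R
    rw [div_lt_iff₀ (by positivity)]
    have : (0:ℝ) ≤ k := Nat.cast_nonneg k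
    nlinarith
  have hb0 : Tendsto (fun k => (b k).rOut) atTop (𝓝 0) := by
    change Tendsto (fun k : ℕ => R / ((k:ℝ) + 2)) atTop (𝓝 0)
    exact tendsto_const_nhds.div_atTop
      (tendsto_atTop_add_const_right _ _ tendsto_natCast_atTop_atTop)
  let ρ : ℕ → Eucl n → ℝ := fun k => (b k).normed volume
  have hρ0 : ∀ k z, 0 ≤ ρ k z := fun k z => (b k).nonneg_normed z
  have hρc : ∀ k, Continuous (ρ k) := fun k => (b k).continuous_normed
  have hρi : ∀ k, Integrable (ρ k) := fun k => (b k).integrable_normed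
  have hρ1 : ∀ k, ∫ z, ρ k z = 1 := fun k => (b k).integral_normed
  have hρR : ∀ k z, ρ k z ≠ 0 → ‖z‖ < R := by
    intro k z hz
    have : z ∈ Function.support ((b k).normed volume) := hz
    rw [(b k).support_normed_eq, mem_ball, dist_zero_right] at this
    exact this.trans (hbR k)
  let φk : ℕ → Eucl n → ℝ := fun k x => ∫ z, ρ k z * φ (x - z)
  have hmolint : ∀ k (w : Eucl n), Integrable fun z => ρ k z * φ (w - z) := by
    intro k w
    refine (hρi k).mono' ((hρi k).1.mul
      (hφ.comp (measurable_const.sub measurable_id)).aestronglyMeasurable)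
      (Eventually.of_forall fun z => ?_)
    rw [norm_mul, Real.norm_of_nonneg (hρ0 k z), Real.norm_of_nonneg (h0 _)]
    exact mul_le_of_le_one_right (hρ0 k z) (h1 _)
  have hk0 : ∀ k x, 0 ≤ φk k x := fun k x =>
    integral_nonneg fun z => mul_nonneg (hρ0 k z) (h0 _)
  have hk1 : ∀ k x, φk k x ≤ 1 := by
    intro k x
    rw [← hρ1 k]
    exact integral_mono (hmolint k x) (hρi k) fun z => mul_le_of_le_one_right (hρ0 k z) (h1 _)
  have hksupp : ∀ k x, x ∉ closedBall x0 (2 * R) → φk k x = 0 := by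
    intro k x hx
    have : ∀ z, ρ k z * φ (x - z) = 0 := by
      intro z
      by_cases hz : ρ k z = 0
      · rw [hz, zero_mul]
      · rw [hsupp, mul_zero]
        intro hxz
        apply hx
        have hzR := hρR k z hz
        rw [mem_closedBall, dist_eq_norm] at hxz ⊢
        have : ‖x - x0‖ ≤ ‖x - z - x0‖ + ‖z‖ := by
          have e : x - x0 = (x - z - x0) + z := by abel
          rw [e]; exact (norm_add_le _ _).trans (by simp)
        linarith
    simp only [φk, this, integral_zero]
  have hkc : ∀ k, ContDiff ℝ (⊤ : ℕ∞) (φk k) := fun k =>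
    HasCompactSupport.contDiff_convolution_left (μ := volume) (ContinuousLinearMap.lsmul ℝ ℝ)
      (b k).hasCompactSupport_normed (b k).contDiff_normed hφi.locallyIntegrable
  have hklim : ∀ᵐ x, Tendsto (fun k => φk k x) atTop (𝓝 (φ x)) :=
    ContDiffBump.ae_convolution_tendsto_right_of_locallyIntegrable (K := 2) hb0
      (Eventually.of_forall fun k => by
        change R / ((k:ℝ) + 2) ≤ 2 * (R / ((k:ℝ) + 2) / 2)
        linarith) hφi.locallyIntegrable
  -- the modular of φ
  have hBm5 : MeasurableSet (ball x0 (5 * R) ×ˢ ball x0 (5 * R)) :=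
    measurableSet_ball.prod measurableSet_ball
  have hBm4 : MeasurableSet (ball x0 (4 * R) ×ˢ ball x0 (4 * R)) :=
    measurableSet_ball.prod measurableSet_ball
  have hPφ : IntegrableOn (PD s g φ) (ball x0 (5 * R) ×ˢ ball x0 (5 * R)) := by
    refine (((near_integrable_lip hn hs0 hs1 hg hL0 hη hL x0 (5 * R)).add
      (near_integrable_u hg hW hU)).const_mul ((2 * l) * (2 * l) ^ qg)).mono'
      (PD_meas s hg.continuous hφ).aestronglyMeasurable (Eventually.of_forall fun p => ?_)
    rw [Real.norm_of_nonneg (PD_nonneg s hg φ p)]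
    have hD : Dq s φ p ≤ Dq s η p + l * Dq s u p := by
      unfold Dq
      rw [← mul_div_assoc, ← add_div]
      exact div_le_div_of_nonneg_right (hφη _ _) (by positivity)
    have := hg.P_add_le (Dq_nonneg s η p) (Dq_nonneg s u p) hl (Dq_nonneg s φ p) hD
    calc PD s g φ p ≤ (2 * l) * (2 * l) ^ qg * (Dq s η p * g (Dq s η p) + Dq s u p * g (Dq s u p))
          / ‖p.1 - p.2‖ ^ n := div_le_div_of_nonneg_right this (by positivity)
      _ = _ := by simp only [PD, Pi.add_apply]; ring
  let H : Eucl n × Eucl n → ENNReal := fun p =>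
    ENNReal.ofReal (Lam * (ball x0 (5 * R) ×ˢ ball x0 (5 * R)).indicator (PD s g φ) p)
  have hHm : Measurable H :=
    (((PD_meas s hg.continuous hφ).indicator hBm5).const_mul Lam).ennreal_ofReal
  have hHfin : ∫⁻ p, H p ≠ ⊤ :=
    ((hPφ.integrable_indicator hBm5).const_mul Lam).lintegral_lt_top.ne
  have key := conv_lemma (μ := (volume : Measure (Eucl n × Eucl n)))
    (X := fun k => Xe n s g K u (φk k)) (Y := Xe n s g K u φ)
    (H := fun k p => ∫⁻ z, ENNReal.ofReal (ρ k z) * H (p - (z, z))) hHfin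
    (fun k => (Xe_meas hs0 hg.continuous hK hLg.1 (hkc k).continuous.measurable).aestronglyMeasurable)
    (Xe_meas hs0 hg.continuous hK hLg.1 hφ).aestronglyMeasurable
    (by
      have ha := (Measure.quasiMeasurePreserving_fst (μ := (volume : Measure (Eucl n)))
        (ν := (volume : Measure (Eucl n)))).ae hklim
      have hb := (Measure.quasiMeasurePreserving_snd (μ := (volume : Measure (Eucl n)))
        (ν := (volume : Measure (Eucl n)))).ae hklim
      rw [Measure.volume_eq_prod]
      filter_upwards [ha, hb] with p hp1 hp2
      unfold Xe
      exact (((hp1.sub hp2).const_mul _).mul_const _).div_const _)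
    (fun k => (lintegral_moll (hρc k).measurable (hρ0 k) (hρi k) (hρ1 k) hHm).1.aemeasurable)
    (fun k => (lintegral_moll (hρc k).measurable (hρ0 k) (hρi k) (hρ1 k) hHm).2.le)
    (by
      intro T hT
      have hsub : ball x0 (4 * R) ⊆ ball x0 (5 * R) := ball_subset_ball (by linarith)
      have hFi : Integrable (fun p => Lam *
          (T * (ball x0 (4 * R) ×ˢ ball x0 (4 * R)).indicator (PD s g u) p +
            Far s g u x0 R p)) :=
        ((((near_integrable_u hg hW (hsub.trans hU)).integrable_indicator hBm4).const_mul T).add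
          (Far_integrable hs0 hg hLg x0 hR)).const_mul Lam
      refine ⟨fun p => ENNReal.ofReal (Lam *
          (T * (ball x0 (4 * R) ×ˢ ball x0 (4 * R)).indicator (PD s g u) p +
            Far s g u x0 R p)), hFi.1.aemeasurable.ennreal_ofReal, hFi.lintegral_lt_top.ne, ?_⟩
      intro k
      refine Eventually.of_forall fun p => ?_
      exact Xe_moll_bound hs0 hg hK hR (hρ0 k) (hρi k) (hρ1 k) (hρR k) hφ h0 h1 (hk0 k) (hk1 k)
        (fun x hx => hksupp k x fun h => hx (closedBall_subset_closedBall (by linarith) h)) hT p)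
  exact ⟨key.1, φk, hkc, hk0, hk1, hksupp, hklim, key.2⟩

theorem isTest_of_supp {n : ℕ} {x0 : Eucl n} {R : ℝ} (hR : 0 < R) {ψ : Eucl n → ℝ}
    (hψ : ContDiff ℝ (⊤ : ℕ∞) ψ) (hsupp : ∀ x, x ∉ closedBall x0 (3 * R) → ψ x = 0) :
    IsTest n (ball x0 (5 * R)) ψ := by
  refine ⟨hψ, HasCompactSupport.intro (isCompact_closedBall x0 (3 * R)) hsupp, ?_⟩
  refine (closure_minimal (s := Function.support ψ) (t := closedBall x0 (3 * R)) ?_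
    isClosed_closedBall).trans (closedBall_subset_ball (by linarith))
  intro x hx
  by_contra h
  exact hx (hsupp x h)

theorem Xe_integrable_smooth {n : ℕ} (hn : 1 ≤ n) {s : ℝ} (hs0 : 0 < s) (hs1 : s < 1) {g : ℝ → ℝ}
    {pg qg : ℝ} (hg : CondG g pg qg)
    {K : Eucl n → Eucl n → ℝ} {lam Lam : ℝ} (hK : CondK n K lam Lam) {u : Eucl n → ℝ}
    {U : Set (Eucl n)} {x0 : Eucl n} {R : ℝ} (hR : 0 < R) (hU : ball x0 (5 * R) ⊆ U)
    (hW : MemWsG n s g u U) (hLg : MemLgs n s g u)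
    {ψ : Eucl n → ℝ} (hψ : ContDiff ℝ (⊤ : ℕ∞) ψ) (h0 : ∀ x, 0 ≤ ψ x) (h1 : ∀ x, ψ x ≤ 1)
    (hsupp : ∀ x, x ∉ closedBall x0 (3 * R) → ψ x = 0) : Integrable (Xe n s g K u ψ) := by
  obtain ⟨C, hC⟩ := hψ.lipschitzWith_of_hasCompactSupport
    (HasCompactSupport.intro (isCompact_closedBall x0 (3 * R)) hsupp) (by simp)
  refine Xe_integrable_lip hn hs0 hs1 hg hK hR hU hW hLg hψ.continuous.measurable h0 h1 hsupp
    (L := C) C.2 fun x y => ?_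
  have := hC.dist_le_mul x y
  rwa [Real.dist_eq, dist_eq_norm] at this

theorem nonneg_of_add_mul {a b : ℝ} (h : ∀ δ : ℝ, 0 < δ → 0 ≤ a + δ * b) : 0 ≤ a := by
  have ht : Tendsto (fun k : ℕ => a + 1 / ((k:ℝ) + 1) * b) atTop (𝓝 (a + 0 * b)) :=
    tendsto_const_nhds.add (tendsto_one_div_add_atTop_nhds_zero_nat.mul_const b)
  rw [zero_mul, add_zero] at ht
  exact ge_of_tendsto' ht fun k => h _ (by positivity)

/-- Either the lower order term is integrable, or it may be dropped. -/
theorem reduce_rhs {n : ℕ} (hn : 1 ≤ n) {s : ℝ} (hs0 : 0 < s) (hs1 : s < 1) {g : ℝ → ℝ}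
    {pg qg : ℝ} (hg : CondG g pg qg)
    {K : Eucl n → Eucl n → ℝ} {lam Lam : ℝ} (hK : CondK n K lam Lam) {u : Eucl n → ℝ}
    {Ω : Set (Eucl n)} (hΩo : IsOpen Ω) {c : Eucl n → ℝ} (hc : LocallyIntegrableOn c Ω)
    (hu : WeakSupersol n s g K c u Ω)
    {U : Set (Eucl n)} {x0 : Eucl n} {R : ℝ} (hR : 0 < R) (hU : ball x0 (5 * R) ⊆ U)
    (hΩ : ball x0 (5 * R) ⊆ Ω)
    (hW : MemWsG n s g u U) :
    ∃ f : Eucl n → ℝ, IntegrableOn f (closedBall x0 (2 * R)) ∧ (∀ x, u x = 0 → f x = 0) ∧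
      ∀ φ : Eucl n → ℝ, ContDiff ℝ (⊤ : ℕ∞) φ → (∀ x, 0 ≤ φ x) → (∀ x, φ x ≤ 1) →
        (∀ x, x ∉ closedBall x0 (2 * R) → φ x = 0) →
        ∫ x in closedBall x0 (2 * R), f x * φ x ≤ ∫ p, Xe n s g K u φ p := by
  have hLg := hu.2.1
  let ζ : ContDiffBump x0 := ⟨2 * R, 3 * R, by positivity, by linarith⟩
  have hζ0 : ∀ x, 0 ≤ ζ x := fun x => ζ.nonneg
  have hζ1 : ∀ x, ζ x ≤ 1 := fun x => ζ.le_one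
  have hζs : ∀ x, x ∉ closedBall x0 (3 * R) → ζ x = 0 := by
    intro x hx
    apply ζ.zero_of_le_dist
    rw [mem_closedBall, not_le] at hx
    exact hx.le
  have hζc : ContDiff ℝ (⊤ : ℕ∞) ζ := ζ.contDiff
  have hsub23 : closedBall x0 (2 * R) ⊆ closedBall x0 (3 * R) :=
    closedBall_subset_closedBall (by linarith)
  have hsub2Ω : closedBall x0 (2 * R) ⊆ Ω := (closedBall_subset_ball (by linarith)).trans hΩ
  by_cases hI : IntegrableOn (fun x => c x * g (u x) * ζ x) Ω
  · refine ⟨fun x => c x * g (u x), ?_, ?_, ?_⟩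
    · refine (hI.mono_set hsub2Ω).congr_fun (fun x hx => ?_) measurableSet_closedBall
      have : ζ x = 1 := ζ.one_of_mem_closedBall hx
      simp only [this, mul_one]
    · intro x hx
      simp only [hx, hg.zero, mul_zero]
    · intro φ hφ h0 h1 hsupp
      have hsupp3 : ∀ x, x ∉ closedBall x0 (3 * R) → φ x = 0 :=
        fun x hx => hsupp x fun h => hx (hsub23 h)
      have := hu.2.2 (ball x0 (5 * R)) isOpen_ball isBounded_ball hΩ φ
        (isTest_of_supp hR hφ hsupp3) h0
      rw [energy_eq] at this
      refine le_trans (le_of_eq ?_) this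
      symm
      apply setIntegral_eq_of_subset_of_forall_sdiff_eq_zero hΩo.measurableSet hsub2Ω
      intro x hx
      rw [hsupp x hx.2, mul_zero]
  · refine ⟨fun _ => 0, integrableOn_zero, fun _ _ => rfl, ?_⟩
    intro φ hφ h0 h1 hsupp
    simp only [zero_mul, integral_zero]
    have hsupp3 : ∀ x, x ∉ closedBall x0 (3 * R) → φ x = 0 :=
      fun x hx => hsupp x fun h => hx (hsub23 h)
    have i1 : Integrable (Xe n s g K u φ) :=
      Xe_integrable_smooth hn hs0 hs1 hg hK hR hU hW hLg hφ h0 h1 hsupp3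
    have i2 : Integrable (Xe n s g K u ζ) :=
      Xe_integrable_smooth hn hs0 hs1 hg hK hR hU hW hLg hζc hζ0 hζ1 hζs
    apply nonneg_of_add_mul (b := ∫ p, Xe n s g K u ζ p)
    intro δ hδ
    have hc' : ContDiff ℝ (⊤ : ℕ∞) (fun x => φ x + δ * ζ x) :=
      hφ.add (contDiff_const.mul hζc)
    have h := hu.2.2 (ball x0 (5 * R)) isOpen_ball isBounded_ball hΩ (fun x => φ x + δ * ζ x)
        (isTest_of_supp hR hc' (fun x hx => by rw [hsupp3 x hx, hζs x hx, mul_zero, add_zero]))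
        (fun x => add_nonneg (h0 x) (mul_nonneg hδ.le (hζ0 x)))
    have hnot : ¬ IntegrableOn (fun x => c x * g (u x) * (φ x + δ * ζ x)) Ω := by
      intro hcon
      apply hI
      have hcm : AEStronglyMeasurable c (volume.restrict Ω) := hc.aestronglyMeasurable
      refine (Integrable.const_mul hcon (1 / δ)).mono
        ((hcm.mul (hg.continuous.measurable.comp hLg.1).aestronglyMeasurable).mul
          hζc.continuous.aestronglyMeasurable) (Eventually.of_forall fun x => ?_)
      have e : c x * g (u x) * ζ x = 1 / δ * (c x * g (u x) * (δ * ζ x)) := by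
        field_simp
      rw [e, norm_mul (1 / δ), norm_mul (1 / δ), norm_mul _ (δ * ζ x),
        norm_mul _ (φ x + δ * ζ x)]
      have hz : 0 ≤ δ * ζ x := mul_nonneg hδ.le (hζ0 x)
      rw [Real.norm_of_nonneg hz, Real.norm_of_nonneg (add_nonneg (h0 x) hz)]
      have := h0 x
      gcongr
      linarith
    rw [integral_undef hnot, energy_eq] at h
    have e : ∀ p, Xe n s g K u (fun x => φ x + δ * ζ x) p
        = Xe n s g K u φ p + δ * Xe n s g K u ζ p := by
      intro p; unfold Xe; ring
    simp only [e] at h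
    rwa [integral_add i1 (i2.const_mul δ), integral_const_mul] at h

theorem CondG.sign_mul {g : ℝ → ℝ} {pg qg : ℝ} (hg : CondG g pg qg) {s : ℝ} {d a b x y : ℝ}
    (hd : 0 ≤ d) (h1 : a ≤ b → y ≤ x) (h2 : b ≤ a → x ≤ y) :
    g ((a - b) / d ^ s) * (x - y) ≤ 0 := by
  have hds : 0 ≤ d ^ s := Real.rpow_nonneg hd s
  rcases le_total a b with h | h
  · have e : (a - b) / d ^ s = -((b - a) / d ^ s) := by ring
    have := hg.nonneg (div_nonneg (sub_nonneg.2 h) hds)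
    rw [e, hg.odd]
    exact mul_nonpos_of_nonpos_of_nonneg (by linarith) (sub_nonneg.2 (h1 h))
  · have := hg.nonneg (div_nonneg (sub_nonneg.2 h) hds)
    exact mul_nonpos_of_nonneg_of_nonpos this (sub_nonpos.2 (h2 h))

theorem Xe_le_abs {n : ℕ} {s : ℝ} {g : ℝ → ℝ} {pg qg : ℝ} (hg : CondG g pg qg)
    {K : Eucl n → Eucl n → ℝ} {lam Lam : ℝ} (hK : CondK n K lam Lam) {u η : Eucl n → ℝ}
    (hη : ∀ x, 0 ≤ η x) {h : ℝ → ℝ} (h0 : ∀ t, 0 ≤ h t) (h1 : ∀ t, h t ≤ 1)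
    (hh : ∀ a b, 0 ≤ a → a ≤ b → h b ≤ h a) {p : Eucl n × Eucl n} (hp1 : 0 ≤ u p.1)
    (hp2 : 0 ≤ u p.2) :
    Xe n s g K u (fun x => η x * h (u x)) p ≤ |Xe n s g K u η p| := by
  by_cases hp : p.1 = p.2
  · simp [Xe, hp]
  have hKp := K_nonneg hK hp
  unfold Xe
  set A := g ((u p.1 - u p.2) / ‖p.1 - p.2‖ ^ s)
  have hB : 0 ≤ K p.1 p.2 / ‖p.1 - p.2‖ ^ s := div_nonneg hKp.le (by positivity)
  have hA : A * (h (u p.1) - h (u p.2)) ≤ 0 :=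
    hg.sign_mul (norm_nonneg _) (hh _ _ hp1) (hh _ _ hp2)
  rw [mul_div_assoc, mul_div_assoc, abs_mul, abs_of_nonneg hB]
  apply mul_le_mul_of_nonneg_right _ hB
  have e : A * (η p.1 * h (u p.1) - η p.2 * h (u p.2))
      = A * (η p.1 - η p.2) * ((h (u p.1) + h (u p.2)) / 2)
        + A * (h (u p.1) - h (u p.2)) * ((η p.1 + η p.2) / 2) := by ring
  have t2 : A * (h (u p.1) - h (u p.2)) * ((η p.1 + η p.2) / 2) ≤ 0 :=
    mul_nonpos_of_nonpos_of_nonneg hA (by linarith [hη p.1, hη p.2])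
  have t1 : A * (η p.1 - η p.2) * ((h (u p.1) + h (u p.2)) / 2) ≤ |A * (η p.1 - η p.2)| := by
    have a1 := h0 (u p.1)
    have a2 := h0 (u p.2)
    calc _ ≤ |A * (η p.1 - η p.2)| * ((h (u p.1) + h (u p.2)) / 2) :=
          mul_le_mul_of_nonneg_right (le_abs_self _) (by linarith)
      _ ≤ |A * (η p.1 - η p.2)| * 1 :=
          mul_le_mul_of_nonneg_left (by linarith [h1 (u p.1), h1 (u p.2)]) (abs_nonneg _)
      _ = _ := mul_one _
  rw [e]; linarith

/-- Indicator of `{0}` as a function. -/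
def hinf (t : ℝ) : ℝ := if t = 0 then 1 else 0

/-- Truncations converging to the indicator of `{0}`. -/
def hj (j : ℕ) (t : ℝ) : ℝ := max 0 (1 - |t| * ((j:ℝ) + 1))

theorem hj_nonneg (j : ℕ) (t : ℝ) : 0 ≤ hj j t := le_max_left _ _

theorem hj_le_one (j : ℕ) (t : ℝ) : hj j t ≤ 1 := by
  have : 0 ≤ |t| * ((j:ℝ) + 1) := by positivity
  exact max_le zero_le_one (by linarith)

theorem hj_anti (j : ℕ) (a b : ℝ) (ha : 0 ≤ a) (hab : a ≤ b) : hj j b ≤ hj j a := by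
  unfold hj
  rw [abs_of_nonneg ha, abs_of_nonneg (ha.trans hab)]
  gcongr

theorem hj_lip (j : ℕ) (a b : ℝ) : |hj j a - hj j b| ≤ ((j:ℝ) + 1) * |a - b| := by
  have h1 : |hj j a - hj j b| ≤ |(1 - |a| * ((j:ℝ) + 1)) - (1 - |b| * ((j:ℝ) + 1))| := by
    unfold hj
    have := abs_max_sub_max_le_max (0:ℝ) (1 - |a| * ((j:ℝ) + 1)) 0 (1 - |b| * ((j:ℝ) + 1))
    simpa using this
  refine h1.trans ?_
  have e : (1 - |a| * ((j:ℝ) + 1)) - (1 - |b| * ((j:ℝ) + 1)) = ((j:ℝ) + 1) * (|b| - |a|) := by ring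
  rw [e, abs_mul, abs_of_nonneg (by positivity : (0:ℝ) ≤ (j:ℝ) + 1), abs_sub_comm a b]
  exact mul_le_mul_of_nonneg_left (abs_abs_sub_abs_le _ _) (by positivity)

theorem hj_meas (j : ℕ) : Measurable (hj j) := by
  have : Continuous (hj j) := by unfold hj; fun_prop
  exact this.measurable

theorem hj_tendsto (t : ℝ) : Tendsto (fun j => hj j t) atTop (𝓝 (hinf t)) := by
  by_cases ht : t = 0
  · simp [hj, hinf, ht]
  · have hp : 0 < |t| := abs_pos.2 ht
    obtain ⟨N, hN⟩ := exists_nat_gt (1 / |t|)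
    have : hinf t = 0 := if_neg ht
    rw [this]
    refine tendsto_const_nhds.congr' ?_
    filter_upwards [eventually_ge_atTop N] with j hj'
    unfold hj
    rw [max_eq_left]
    have h1 : (N:ℝ) ≤ j := by exact_mod_cast hj'
    rw [div_lt_iff₀ hp] at hN
    nlinarith

theorem Xe_hinf_nonpos {n : ℕ} {s : ℝ} {g : ℝ → ℝ} {pg qg : ℝ} (hg : CondG g pg qg)
    {K : Eucl n → Eucl n → ℝ} {lam Lam : ℝ} (hK : CondK n K lam Lam) {u η : Eucl n → ℝ}
    (hη : ∀ x, 0 ≤ η x) {p : Eucl n × Eucl n} (hp1 : 0 ≤ u p.1) (hp2 : 0 ≤ u p.2) :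
    Xe n s g K u (fun x => η x * hinf (u x)) p ≤ 0 := by
  by_cases hp : p.1 = p.2
  · simp [Xe, hp]
  have hKp := K_nonneg hK hp
  have hB : 0 ≤ K p.1 p.2 / ‖p.1 - p.2‖ ^ s := div_nonneg hKp.le (by positivity)
  unfold Xe
  rw [mul_div_assoc]
  refine mul_nonpos_of_nonpos_of_nonneg ?_ hB
  by_cases heq : u p.1 = u p.2
  · simp [heq, hg.zero]
  · apply hg.sign_mul (norm_nonneg _)
    · intro h
      have h2 : u p.2 ≠ 0 := by
        intro h0; apply heq; linarith
      simp only [hinf, if_neg h2, mul_zero]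
      split_ifs <;> simp [hη]
    · intro h
      have h2 : u p.1 ≠ 0 := by
        intro h0; apply heq; linarith
      simp only [hinf, if_neg h2, mul_zero]
      split_ifs <;> simp [hη]

theorem local_step {n : ℕ} (hn : 1 ≤ n) {s : ℝ} (hs0 : 0 < s) (hs1 : s < 1) {g : ℝ → ℝ}
    {pg qg : ℝ} (hg : CondG g pg qg)
    {K : Eucl n → Eucl n → ℝ} {lam Lam : ℝ} (hK : CondK n K lam Lam) {u : Eucl n → ℝ}
    {Ω : Set (Eucl n)} (hΩo : IsOpen Ω) {c : Eucl n → ℝ} (hc : LocallyIntegrableOn c Ω)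
    (hu : WeakSupersol n s g K c u Ω) (hnn : ∀ᵐ (x : Eucl n) ∂volume, 0 ≤ u x)
    {U : Set (Eucl n)} {x0 : Eucl n} {R : ℝ} (hR : 0 < R) (hU : ball x0 (5 * R) ⊆ U)
    (hΩ : ball x0 (5 * R) ⊆ Ω) (hW : MemWsG n s g u U) :
    ∃ η : Eucl n → ℝ, (∀ x ∈ closedBall x0 (R / 2), η x = 1) ∧
      ∀ᵐ p : Eucl n × Eucl n, Xe n s g K u (fun x => η x * hinf (u x)) p = 0 := by
  have hLg := hu.2.1
  obtain ⟨f, hf, hfu, hfE⟩ := reduce_rhs hn hs0 hs1 hg hK hΩo hc hu hR hU hΩ hW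
  let η : ContDiffBump x0 := ⟨R / 2, R, by positivity, by linarith⟩
  have hη0 : ∀ x, 0 ≤ η x := fun x => η.nonneg
  have hη1 : ∀ x, η x ≤ 1 := fun x => η.le_one
  have hηs : ∀ x, x ∉ closedBall x0 R → η x = 0 := by
    intro x hx
    apply η.zero_of_le_dist
    rw [mem_closedBall, not_le] at hx
    exact hx.le
  have hηc : ContDiff ℝ (⊤ : ℕ∞) η := η.contDiff
  have hηm : Measurable η := hηc.continuous.measurable
  obtain ⟨C, hC⟩ := hηc.lipschitzWith_of_hasCompactSupport
    (HasCompactSupport.intro (isCompact_closedBall x0 R) hηs) (by simp)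
  have hηL : ∀ x y, |η x - η y| ≤ C * ‖x - y‖ := fun x y => by
    have := hC.dist_le_mul x y
    rwa [Real.dist_eq, dist_eq_norm] at this
  let φ : ℕ → Eucl n → ℝ := fun j x => η x * hj j (u x)
  have hφm : ∀ j, Measurable (φ j) := fun j => hηm.mul ((hj_meas j).comp hLg.1)
  have hφ0 : ∀ j x, 0 ≤ φ j x := fun j x => mul_nonneg (hη0 x) (hj_nonneg j _)
  have hφ1 : ∀ j x, φ j x ≤ 1 := fun j x =>
    mul_le_one₀ (hη1 x) (hj_nonneg j _) (hj_le_one j _)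
  have hmol := fun j => mollify_energy hn hs0 hs1 hg hK hR hU hW hLg (hφm j) (hφ0 j) (hφ1 j)
    (fun x hx => by simp only [φ, hηs x hx, zero_mul]) hηm (L := C) (l := (j:ℝ) + 1) C.2 hηL
    (by have : (0:ℝ) ≤ j := Nat.cast_nonneg j
        linarith)
    (fun x y => by
      have e : φ j x - φ j y = (η x - η y) * hj j (u x) + η y * (hj j (u x) - hj j (u y)) := by
        simp only [φ]; ring
      rw [e]
      refine (abs_add_le _ _).trans (add_le_add ?_ ?_)
      · rw [abs_mul, abs_of_nonneg (hj_nonneg j _)]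
        exact mul_le_of_le_one_right (abs_nonneg _) (hj_le_one j _)
      · rw [abs_mul, abs_of_nonneg (hη0 y)]
        exact (mul_le_of_le_one_left (abs_nonneg _) (hη1 y)).trans (hj_lip j _ _))
  -- the inequality for `φ j`
  have hineq : ∀ j, ∫ x in closedBall x0 (2 * R), f x * φ j x ≤ ∫ p, Xe n s g K u (φ j) p := by
    intro j
    obtain ⟨-, φk, hkc, hk0, hk1, hks, hkl, hkE⟩ := hmol j
    have ht : Tendsto (fun k => ∫ x in closedBall x0 (2 * R), f x * φk k x) atTop
        (𝓝 (∫ x in closedBall x0 (2 * R), f x * φ j x)) := by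
      refine tendsto_integral_of_dominated_convergence (fun x => ‖f x‖)
        (fun k => hf.1.mul (hkc k).continuous.aestronglyMeasurable) hf.norm
        (fun k => Eventually.of_forall fun x => ?_) ?_
      · rw [norm_mul, Real.norm_of_nonneg (hk0 k x)]
        exact mul_le_of_le_one_right (norm_nonneg _) (hk1 k x)
      · filter_upwards [ae_restrict_of_ae hkl] with x hx
        exact hx.const_mul _
    exact le_of_tendsto_of_tendsto' ht hkE fun k => hfE (φk k) (hkc k) (hk0 k) (hk1 k) (hks k)
  have hr : Tendsto (fun j => ∫ x in closedBall x0 (2 * R), f x * φ j x) atTop (𝓝 0) := by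
    have h0 : (0:ℝ) = ∫ x in closedBall x0 (2 * R), (0:ℝ) := by simp
    rw [h0]
    refine tendsto_integral_of_dominated_convergence (fun x => ‖f x‖)
        (fun k => hf.1.mul (hφm k).aestronglyMeasurable) hf.norm
        (fun k => Eventually.of_forall fun x => ?_) (Eventually.of_forall fun x => ?_)
    · rw [norm_mul, Real.norm_of_nonneg (hφ0 k x)]
      exact mul_le_of_le_one_right (norm_nonneg _) (hφ1 k x)
    · have : f x * (η x * hinf (u x)) = 0 := by
        by_cases h : u x = 0
        · rw [hfu x h, zero_mul]
        · rw [hinf, if_neg h, mul_zero, mul_zero]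
      rw [← this]
      exact ((hj_tendsto (u x)).const_mul _).const_mul _
  have hnn2 : ∀ᵐ p : Eucl n × Eucl n, 0 ≤ u p.1 ∧ 0 ≤ u p.2 := by
    have ha := (Measure.quasiMeasurePreserving_fst (μ := (volume : Measure (Eucl n)))
      (ν := (volume : Measure (Eucl n)))).ae hnn
    have hb := (Measure.quasiMeasurePreserving_snd (μ := (volume : Measure (Eucl n)))
      (ν := (volume : Measure (Eucl n)))).ae hnn
    rw [Measure.volume_eq_prod]
    filter_upwards [ha, hb] with p hp1 hp2
    exact ⟨hp1, hp2⟩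
  have hηE : Integrable (Xe n s g K u η) :=
    Xe_integrable_smooth hn hs0 hs1 hg hK hR hU hW hLg hηc hη0 hη1
      (fun x hx => hηs x fun h => hx (closedBall_subset_closedBall (by linarith) h))
  refine ⟨η, fun x hx => η.one_of_mem_closedBall hx, ?_⟩
  refine rev_fatou (X := fun j => Xe n s g K u (φ j)) (F := fun p => |Xe n s g K u η p|) hr
    (fun j => (hmol j).1) hηE.abs (Eventually.of_forall fun p => ?_) (fun j => ?_)
    (fun p => abs_nonneg _) ?_ hineq
  · unfold Xe
    exact (((((hj_tendsto (u p.1)).const_mul _).sub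
      ((hj_tendsto (u p.2)).const_mul _)).const_mul _).mul_const _).div_const _
  · filter_upwards [hnn2] with p hp
    exact Xe_le_abs hg hK hη0 (hj_nonneg j) (hj_le_one j) (hj_anti j) hp.1 hp.2
  · filter_upwards [hnn2] with p hp
    exact Xe_hinf_nonpos hg hK hη0 hp.1 hp.2

/-- Theorem 1.1(2), `c ∈ L¹_loc`, global nonnegativity:
strong minimum principle for weak supersolutions of `𝓛 u = c(x) g(|u|) u/|u|`. -/
theorem strong_minimum_principle_L1_global
    (n : ℕ) (hn : 1 ≤ n) (s : ℝ) (hs0 : 0 < s) (hs1 : s < 1)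
    (g : ℝ → ℝ) (pg qg : ℝ) (hg : CondG g pg qg)
    (K : Eucl n → Eucl n → ℝ) (lam Lam : ℝ) (hK : CondK n K lam Lam)
    (Ω : Set (Eucl n)) (hΩo : IsOpen Ω)
    (c : Eucl n → ℝ) (hc : LocallyIntegrableOn c Ω) (hc0 : ∀ x ∈ Ω, c x ≤ 0)
    (u : Eucl n → ℝ) (hu : WeakSupersol n s g K c u Ω)
    (hnn : ∀ᵐ (x : Eucl n) ∂volume, 0 ≤ u x) :
    (∀ᵐ (x : Eucl n) ∂volume, x ∈ Ω → 0 < u x) ∨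
      (∀ᵐ (x : Eucl n) ∂volume, u x = 0) := by
  by_cases hpos : ∀ᵐ (x : Eucl n) ∂volume, x ∈ Ω → 0 < u x
  · exact Or.inl hpos
  right
  have hum : Measurable u := hu.2.1.1
  have hZm : volume (Ω ∩ {x | u x = 0}) ≠ 0 := by
    intro h0
    apply hpos
    have : ∀ᵐ x ∂(volume : Measure (Eucl n)), x ∉ Ω ∩ {x | u x = 0} :=
      measure_eq_zero_iff_ae_notMem.1 h0
    filter_upwards [this, hnn] with x hx hx0 hxΩ
    exact lt_of_le_of_ne hx0 fun h => hx ⟨hxΩ, h.symm⟩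
  obtain ⟨x0, hx0, hx0m⟩ := exists_mem_forall_mem_nhdsWithin_pos_measure hZm
  obtain ⟨ε, hε, hεΩ⟩ := Metric.isOpen_iff.1 hΩo x0 hx0.1
  obtain ⟨R, hR, hRε⟩ : ∃ R : ℝ, 0 < R ∧ 5 * R < ε := ⟨ε / 10, by positivity, by linarith⟩
  have hcl : closure (ball x0 (5 * R)) ⊆ Ω :=
    closure_ball_subset_closedBall.trans ((closedBall_subset_ball hRε).trans hεΩ)
  obtain ⟨U, -, hUc, hW⟩ := hu.1 (ball x0 (5 * R)) isOpen_ball isBounded_ball hcl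
  obtain ⟨η, hη1, hY⟩ := local_step hn hs0 hs1 hg hK hΩo hc hu hnn hR
    (subset_closure.trans hUc) (subset_closure.trans hcl) hW
  let Zb : Set (Eucl n) := (Ω ∩ {x | u x = 0}) ∩ closedBall x0 (R / 2)
  have hZb : 0 < volume Zb := by
    apply hx0m
    exact inter_mem self_mem_nhdsWithin
      (mem_nhdsWithin_of_mem_nhds (closedBall_mem_nhds x0 (by positivity)))
  let P : Set (Eucl n) := {x | 0 < u x}
  have hnull : (volume : Measure (Eucl n × Eucl n)) (Zb ×ˢ P) = 0 := by
    rw [measure_eq_zero_iff_ae_notMem]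
    filter_upwards [hY] with p hp hmem
    obtain ⟨⟨⟨-, h1⟩, h2⟩, h3⟩ := hmem
    have h1' : u p.1 = 0 := h1
    have h3' : 0 < u p.2 := h3
    have hne : p.1 ≠ p.2 := by
      intro h; rw [h] at h1'; linarith
    have hd : 0 < ‖p.1 - p.2‖ := norm_pos_iff.2 (sub_ne_zero.2 hne)
    have hKp := K_nonneg hK hne
    have hds : 0 < ‖p.1 - p.2‖ ^ s := Real.rpow_pos_of_pos hd s
    have hgp : 0 < g (u p.2 / ‖p.1 - p.2‖ ^ s) := hg.pos (div_pos h3' hds)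
    have e : (u p.1 - u p.2) / ‖p.1 - p.2‖ ^ s = -(u p.2 / ‖p.1 - p.2‖ ^ s) := by
      rw [h1']; ring
    unfold Xe at hp
    rw [e, hg.odd] at hp
    simp only [hη1 _ h2, hinf, if_pos h1', if_neg h3'.ne'] at hp
    have : 0 < g (u p.2 / ‖p.1 - p.2‖ ^ s) * K p.1 p.2 / ‖p.1 - p.2‖ ^ s := by positivity
    have e2 : -g (u p.2 / ‖p.1 - p.2‖ ^ s) * (1 * 1 - η p.2 * 0) * K p.1 p.2 / ‖p.1 - p.2‖ ^ s
        = -(g (u p.2 / ‖p.1 - p.2‖ ^ s) * K p.1 p.2 / ‖p.1 - p.2‖ ^ s) := by ring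
    rw [e2] at hp
    linarith
  rw [Measure.volume_eq_prod, Measure.prod_prod, mul_eq_zero] at hnull
  have hP : volume P = 0 := hnull.resolve_left hZb.ne'
  have hP' : ∀ᵐ x ∂(volume : Measure (Eucl n)), x ∉ P := measure_eq_zero_iff_ae_notMem.1 hP
  filter_upwards [hP', hnn] with x hx hx0
  exact le_antisymm (not_lt.1 hx) hx0
end
end

section
/- Continuity of 𝓛ψ for admissible test functions (Lemma 2.3): Let Ω ⊂ ℝⁿ be a bounded open set, B_r(x₀) ⊂ Ω, and ψ ∈ C²(B_r(x₀)) ∩ L^g_s(ℝⁿ). If 1 < p ≤ 2/(2−s), assume moreover that ψ ∈ C²_β(B_r(x₀)) for some β > sp/(p−1), Dψ(x₀) = 0, and x₀ is an isolated critical point of ψ in B_r(x₀). Then the function x ↦ 𝓛ψ(x) is continuous in B_r(x₀). -/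
open MeasureTheory Metric Set Filter Topology Bornology
open scoped Classical

noncomputable section

namespace LpsiAux

theorem g_mono {g : ℝ → ℝ} {pg qg : ℝ} (hg : CondG g pg qg) : StrictMono g := by
  have h1 : StrictMonoOn g (Iic 0) := by
    intro a ha b hb hab
    have := hg.mono (a := -b) (b := -a) (by simpa using hb) (by simpa using ha) (by linarith)
    rw [hg.odd, hg.odd] at this
    linarith
  exact h1.Iic_union_Ici hg.mono

theorem g_cont {g : ℝ → ℝ} {pg qg : ℝ} (hg : CondG g pg qg) : Continuous g := by
  have h1 : ContinuousOn g (Iic 0) := by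
    have : ContinuousOn (fun t => - g (-t)) (Iic 0) := by
      apply ContinuousOn.neg
      apply hg.cont.comp (by fun_prop)
      intro x hx
      simpa using hx
    refine this.congr ?_
    intro t _
    simp [hg.odd]
  have h2 := h1.union_of_isClosed hg.cont isClosed_Iic isClosed_Ici
  rw [Iic_union_Ici] at h2
  exact continuousOn_univ.1 h2

theorem g_abs {g : ℝ → ℝ} {pg qg : ℝ} (hg : CondG g pg qg) (t : ℝ) : |g t| = g |t| := by
  have hm := (g_mono hg).monotone
  rcases le_total 0 t with h | h
  · have := hm h
    rw [hg.zero] at this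
    rw [abs_of_nonneg h, abs_of_nonneg this]
  · have := hm h
    rw [hg.zero] at this
    rw [abs_of_nonpos h, abs_of_nonpos this, hg.odd]

theorem g_nonneg {g : ℝ → ℝ} {pg qg : ℝ} (hg : CondG g pg qg) {t : ℝ} (ht : 0 ≤ t) : 0 ≤ g t := by
  have := (g_mono hg).monotone ht
  rwa [hg.zero] at this

theorem g_lip {g : ℝ → ℝ} {pg qg : ℝ} (hg : CondG g pg qg) (T : ℝ) (hT : 0 ≤ T) :
    ∃ C, 0 ≤ C ∧ ∀ a b, |a| ≤ T → |b| ≤ T → |g a - g b| ≤ C * |a - b| := by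
  have hm := (g_mono hg).monotone
  have hC : 0 ≤ g (T + 1) - g T := sub_nonneg.2 (hm (by linarith))
  refine ⟨g (T+1) - g T, hC, ?_⟩
  set C := g (T+1) - g T with hCdef
  have key : ∀ a b, 0 ≤ a → a ≤ b → b ≤ T → g b - g a ≤ C * (b - a) := by
    intro a b ha hab hb
    rcases hab.eq_or_lt with rfl | hab
    · simp
    have h1 := hg.convex.secant_mono (a := a) (x := b) (y := T+1) ha (ha.trans hab.le : (0:ℝ) ≤ b)
      (by simp; linarith) hab.ne' (by linarith) (by linarith)
    have h2 : (g (T+1) - g a) / (T + 1 - a) ≤ C := by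
      rcases (hab.le.trans hb).eq_or_lt with h | h
      · rw [h]; simp [hCdef]
      · have h3 := hg.convex.secant_mono (a := T+1) (x := a) (y := T) (by simp; linarith) ha
          (hT : (0:ℝ) ≤ T) (by linarith) (by linarith) h.le
        rw [← neg_div_neg_eq, neg_sub, neg_sub] at h3
        refine h3.trans (le_of_eq ?_)
        rw [hCdef]
        have : T - (T + 1) = -1 := by ring
        rw [this]; ring
    have h3 := h1.trans h2
    rwa [div_le_iff₀ (by linarith)] at h3
  have key2 : ∀ a b, |a| ≤ T → |b| ≤ T → a ≤ b → g b - g a ≤ C * (b - a) := by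
    intro a b ha hb hab
    rw [abs_le] at ha hb
    rcases le_total 0 a with h | h
    · exact key a b h hab hb.2
    rcases le_total 0 b with h' | h'
    · have h1 := key 0 b le_rfl h' hb.2
      have h2 := key 0 (-a) le_rfl (by linarith) (by linarith)
      rw [hg.zero] at h1 h2
      rw [hg.odd] at h2
      nlinarith
    · have h2 := key (-b) (-a) (by linarith) (by linarith) (by linarith)
      rw [hg.odd, hg.odd] at h2
      nlinarith
  intro a b ha hb
  rcases le_total a b with h | h
  · rw [abs_sub_comm, abs_sub_comm a b, abs_of_nonneg (sub_nonneg.2 h),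
      abs_of_nonneg (sub_nonneg.2 (hm h))]
    exact key2 a b ha hb h
  · rw [abs_of_nonneg (sub_nonneg.2 h), abs_of_nonneg (sub_nonneg.2 (hm h))]
    exact key2 b a hb ha h

theorem g_doubling {g : ℝ → ℝ} {pg qg : ℝ} (hg : CondG g pg qg) (A : ℝ) (hA : 1 ≤ A) :
    ∃ C, 0 ≤ C ∧ ∀ t, 0 ≤ t → g (A * t) ≤ C * g t := by
  have hA0 : 0 < A := by linarith
  refine ⟨A ^ qg, by positivity, ?_⟩
  have hanti : AntitoneOn (fun t => g t * t ^ (-qg)) (Ioi 0) := by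
    have hd : ∀ t ∈ Ioi (0:ℝ), HasDerivAt (fun t => g t * t ^ (-qg))
        (deriv g t * t ^ (-qg) + g t * (-qg * t ^ (-qg - 1))) t := by
      intro t ht
      exact (hg.diff t ht).hasDerivAt.mul (Real.hasDerivAt_rpow_const (Or.inl (ne_of_gt ht)))
    apply antitoneOn_of_deriv_nonpos (convex_Ioi 0)
    · intro t ht
      exact (hd t ht).continuousAt.continuousWithinAt
    · intro t ht
      rw [interior_Ioi] at ht
      exact (hd t ht).differentiableAt.differentiableWithinAt
    · intro t ht
      rw [interior_Ioi] at ht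
      have ht' : (0:ℝ) < t := ht
      rw [(hd t ht).deriv]
      have : t ^ (-qg) = t ^ (-qg - 1) * t := by
        rw [← Real.rpow_add_one ht'.ne']; congr 1; ring
      rw [this]
      have h1 := hg.upper t ht'
      have h2 : 0 ≤ t ^ (-qg - 1) := by positivity
      nlinarith
  intro t ht
  rcases ht.eq_or_lt with rfl | ht
  · simp [hg.zero]
  have h := hanti (a := t) (b := A * t) ht (by simp; positivity) (by nlinarith)
  simp only at h
  rw [Real.mul_rpow hA0.le ht.le, Real.rpow_neg hA0.le] at h
  have h3 : 0 < t ^ (-qg) := by positivity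
  have h4 : 0 < A ^ qg := by positivity
  have h5 : g (A * t) * (A ^ qg)⁻¹ ≤ g t := by
    apply le_of_mul_le_mul_right _ h3
    linarith
  rw [← div_eq_mul_inv, div_le_iff₀ h4] at h5
  linarith

theorem int_pow {n : ℕ} (hn : 1 ≤ n) {a : ℝ} (ha : -(n:ℝ) < a) (ρ : ℝ) :
    IntegrableOn (fun z : Eucl n => ‖z‖ ^ a) (ball 0 ρ) := by
  have : Nonempty (Fin n) := ⟨⟨0, hn⟩⟩
  rw [integrableOn_fun_norm_addHaar volume (f := fun t : ℝ => t ^ a)]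
  simp only [finrank_euclideanSpace, Fintype.card_fin, smul_eq_mul]
  have h := (intervalIntegral.intervalIntegrable_rpow' (a := 0) (b := ρ) (r := n - 1 + a)
    (by linarith)).1
  rw [integrableOn_Ioc_iff_integrableOn_Ioo] at h
  refine h.congr_fun ?_ measurableSet_Ioo
  intro t ht
  simp only
  rw [Real.rpow_add ht.1, ← Nat.cast_pred (by omega), Real.rpow_natCast]


/-- The integrand. -/
def ff (n : ℕ) (s : ℝ) (g : ℝ → ℝ) (K : Eucl n → Eucl n → ℝ) (ψ : Eucl n → ℝ)
    (x y : Eucl n) : ℝ := g ((ψ x - ψ y) / ‖x - y‖ ^ s) * K x y / ‖x - y‖ ^ s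

theorem K_eq {n : ℕ} {K : Eucl n → Eucl n → ℝ} {lam Lam : ℝ} (hK : CondK n K lam Lam)
    (x y : Eucl n) : K x y = K 0 (y - x) := by
  have := hK.transl 0 (y - x) x
  simpa using this

theorem K_neg {n : ℕ} {K : Eucl n → Eucl n → ℝ} {lam Lam : ℝ} (hK : CondK n K lam Lam)
    (z : Eucl n) : K 0 (-z) = K 0 z := by
  have := K_eq hK z 0
  rw [hK.symm z 0] at this
  simpa using this.symm

theorem k_cont {n : ℕ} {K : Eucl n → Eucl n → ℝ} {lam Lam : ℝ} (hK : CondK n K lam Lam) :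
    ContinuousOn (fun z => K 0 z) {(0 : Eucl n)}ᶜ := by
  have : ContinuousOn (fun z : Eucl n => ((0 : Eucl n), z)) {(0 : Eucl n)}ᶜ := by fun_prop
  refine hK.cont.comp this ?_
  intro z hz
  simpa [eq_comm] using hz

theorem k_meas {n : ℕ} {K : Eucl n → Eucl n → ℝ} {lam Lam : ℝ} (hK : CondK n K lam Lam) :
    Measurable (fun z => K 0 z) :=
  measurable_of_continuousOn_compl_singleton 0 (k_cont hK)

theorem k_bound {n : ℕ} {K : Eucl n → Eucl n → ℝ} {lam Lam : ℝ} (hK : CondK n K lam Lam)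
    {x y : Eucl n} (hxy : x ≠ y) : |K x y| ≤ Lam / ‖x - y‖ ^ n := by
  have h1 := hK.lower x y hxy
  have h2 := hK.upper x y hxy
  have h3 : 0 ≤ lam / ‖x - y‖ ^ n := div_nonneg hK.lam_pos.le (by positivity)
  rw [abs_of_nonneg (h3.trans h1)]
  exact h2

theorem ff_meas {n : ℕ} {s : ℝ} {g : ℝ → ℝ} {pg qg : ℝ} (hg : CondG g pg qg)
    {K : Eucl n → Eucl n → ℝ} {lam Lam : ℝ} (hK : CondK n K lam Lam) {ψ : Eucl n → ℝ}
    (hψ : Measurable ψ) (x : Eucl n) : Measurable (ff n s g K ψ x) := by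
  have h1 : Measurable (fun y => K x y) := by
    have : (fun y => K x y) = fun y => K 0 (y - x) := by
      funext y; exact K_eq hK x y
    rw [this]
    exact (k_meas hK).comp (by fun_prop)
  have h2 := (g_cont hg).measurable
  unfold ff
  have h3 : Measurable (fun y : Eucl n => ‖x - y‖ ^ s) := by fun_prop
  exact ((h2.comp ((measurable_const.sub hψ).div h3)).mul h1).div h3

theorem reg {n : ℕ} {x₀ : Eucl n} {r : ℝ} {ψ : Eucl n → ℝ} (hψ : ContDiffOn ℝ 2 ψ (ball x₀ r))
    {xs : Eucl n} (hxs : xs ∈ ball x₀ r) :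
    ∃ ρ L M : ℝ, 0 < ρ ∧ 0 ≤ L ∧ 0 ≤ M ∧ ∀ x ∈ ball xs ρ, x ∈ ball x₀ r ∧ ∀ z : Eucl n, ‖z‖ < ρ →
      x + z ∈ ball x₀ r ∧ |ψ x - ψ (x + z)| ≤ L * ‖z‖ ∧
      |ψ (x + z) + ψ (x - z) - 2 * ψ x| ≤ M * ‖z‖ ^ 2 := by
  have hc : ContDiffAt ℝ 2 ψ xs := hψ.contDiffAt (isOpen_ball.mem_nhds hxs)
  obtain ⟨L, t1, ht1, hL⟩ := (hc.of_le (by norm_num : (1 : WithTop ℕ∞) ≤ 2)).exists_lipschitzOnWith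
  have hD : ContDiffAt ℝ 1 (fderiv ℝ ψ) xs := hc.fderiv_right (by norm_num)
  obtain ⟨M, t2, ht2, hM⟩ := hD.exists_lipschitzOnWith
  obtain ⟨R, hR, hRs⟩ := Metric.mem_nhds_iff.1
    (inter_mem (inter_mem ht1 ht2) (isOpen_ball.mem_nhds hxs))
  have hin : ∀ x ∈ ball xs (R/2), ∀ z : Eucl n, ‖z‖ < R/2 → x + z ∈ ball xs R := by
    intro x hx z hz
    rw [mem_ball, dist_eq_norm] at *
    calc ‖x + z - xs‖ = ‖(x - xs) + z‖ := by congr 1; abel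
      _ ≤ ‖x - xs‖ + ‖z‖ := norm_add_le _ _
      _ < R := by linarith
  have hin0 : ∀ x ∈ ball xs (R/2), x ∈ ball xs R := fun x hx => ball_subset_ball (by linarith) hx
  refine ⟨R/2, L, 2 * M, by positivity, L.2, by positivity, ?_⟩
  intro x hx
  refine ⟨(hRs (hin0 x hx)).2, ?_⟩
  intro z hz
  refine ⟨(hRs (hin x hx z hz)).2, ?_, ?_⟩
  · have := hL.dist_le_mul x (hRs (hin0 x hx)).1.1 (x+z) (hRs (hin x hx z hz)).1.1
    rw [Real.dist_eq] at this
    simpa [dist_eq_norm] using this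
  · have hder : ∀ w ∈ closedBall (0 : Eucl n) ‖z‖,
        HasFDerivWithinAt (fun w => ψ (x + w) + ψ (x - w)) (fderiv ℝ ψ (x + w) - fderiv ℝ ψ (x - w))
          (closedBall (0 : Eucl n) ‖z‖) w := by
      intro w hw
      have hw' : ‖w‖ < R/2 := by
        have : ‖w‖ ≤ ‖z‖ := by simpa using hw
        linarith
      have d1 : HasFDerivAt ψ (fderiv ℝ ψ (x + w)) (x + w) :=
        ((hψ.contDiffAt (isOpen_ball.mem_nhds (hRs (hin x hx w hw')).2)).differentiableAt
          (by norm_num)).hasFDerivAt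
      have d2 : HasFDerivAt ψ (fderiv ℝ ψ (x - w)) (x - w) := by
        have := (hRs (hin x hx (-w) (by simpa using hw'))).2
        rw [← sub_eq_add_neg] at this
        exact ((hψ.contDiffAt (isOpen_ball.mem_nhds this)).differentiableAt
          (by norm_num)).hasFDerivAt
      have e1 : HasFDerivAt (fun w : Eucl n => x + w) (ContinuousLinearMap.id ℝ (Eucl n)) w :=
        (hasFDerivAt_id w).const_add x
      have e2 : HasFDerivAt (fun w : Eucl n => x - w) (-ContinuousLinearMap.id ℝ (Eucl n)) w :=
        (hasFDerivAt_id w).const_sub x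
      have := (d1.comp w e1).add (d2.comp w e2)
      refine HasFDerivAt.hasFDerivWithinAt ?_
      convert! this using 1
      ext v
      simp [sub_eq_add_neg]
    have hbd : ∀ w ∈ closedBall (0 : Eucl n) ‖z‖,
        ‖fderiv ℝ ψ (x + w) - fderiv ℝ ψ (x - w)‖ ≤ 2 * M * ‖z‖ := by
      intro w hw
      have hw1 : ‖w‖ ≤ ‖z‖ := by simpa using hw
      have hw' : ‖w‖ < R/2 := by linarith
      have h2 := (hRs (hin x hx (-w) (by simpa using hw'))).1.2
      rw [← sub_eq_add_neg] at h2
      have := hM.dist_le_mul (x + w) (hRs (hin x hx w hw')).1.2 (x - w) h2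
      rw [dist_eq_norm, dist_eq_norm] at this
      have h3 : ‖x + w - (x - w)‖ ≤ 2 * ‖w‖ := by
        have : x + w - (x - w) = w + w := by abel
        rw [this]
        linarith [norm_add_le w w]
      have hM0 : (0:ℝ) ≤ M := M.2
      calc _ ≤ M * ‖x + w - (x - w)‖ := this
        _ ≤ M * (2 * ‖z‖) := by gcongr; linarith
        _ = _ := by ring
    have := (convex_closedBall (0 : Eucl n) ‖z‖).norm_image_sub_le_of_norm_hasFDerivWithin_le
      hder hbd (x := 0) (y := z) (by simp) (by simp)
    simp only [add_zero, sub_zero, Real.norm_eq_abs] at this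
    have e : ψ (x + z) + ψ (x - z) - 2 * ψ x = ψ (x + z) + ψ (x - z) - (ψ x + ψ x) := by ring
    rw [e]
    refine this.trans (le_of_eq (by ring))

theorem far_bound {n : ℕ} {s : ℝ} (hs0 : 0 < s) (hs1 : s < 1)
    {g : ℝ → ℝ} {pg qg : ℝ} (hg : CondG g pg qg)
    {K : Eucl n → Eucl n → ℝ} {lam Lam : ℝ} (hK : CondK n K lam Lam) {ψ : Eucl n → ℝ}
    (hψL : MemLgs n s g ψ) (xs : Eucl n) (ρ P : ℝ) (hρ : 0 < ρ)
    (hP : ∀ x ∈ ball xs ρ, |ψ x| ≤ P) :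
    ∃ bd : Eucl n → ℝ, Integrable bd ∧ (∀ y, 0 ≤ bd y) ∧
      ∀ x ∈ ball xs ρ, ∀ y, ρ ≤ ‖x - y‖ → |ff n s g K ψ x y| ≤ bd y := by
  have hP0 : 0 ≤ P := (abs_nonneg _).trans (hP xs (mem_ball_self hρ))
  set A : ℝ := (1 + ‖xs‖ + ρ) / ρ + 1 with hAdef
  have hA1 : 1 ≤ A := by
    have : 0 ≤ (1 + ‖xs‖ + ρ) / ρ := by positivity
    linarith
  have hA0 : 0 < A := by linarith
  have hLam : 0 < Lam := hK.lam_pos.trans_le hK.lam_le_Lam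
  obtain ⟨C1, hC1, hC1'⟩ := g_doubling hg A hA1
  obtain ⟨C2, hC2, hC2'⟩ := g_doubling hg 2 (by norm_num)
  set w : Eucl n → ℝ := fun y => |ψ y| / (1 + ‖y‖) ^ s with hw
  have hm := (g_mono hg).monotone
  have hw0 : ∀ y, 0 ≤ w y := fun y => by positivity
  set B : ℝ := C1 * (Lam * A ^ ((n:ℝ) + s)) with hB
  have hB0 : 0 ≤ B := by positivity
  have hsum : ∀ y, g (P + w y) ≤ g (2 * P) + C2 * g (w y) := by
    intro y
    have h1 := g_nonneg hg (t := 2 * P) (by positivity)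
    have h2 := g_nonneg hg (t := w y) (hw0 y)
    rcases le_total P (w y) with h | h
    · have := hC2' (w y) (hw0 y)
      have h3 := hm (show P + w y ≤ 2 * w y by linarith)
      linarith
    · have h3 := hm (show P + w y ≤ 2 * P by linarith)
      have : 0 ≤ C2 * g (w y) := by positivity
      linarith
  refine ⟨fun y => B * g (2 * P) * (1 + ‖y‖) ^ (-((n:ℝ) + s)) +
    B * C2 * (g (w y) / (1 + ‖y‖) ^ ((n:ℝ) + s)), ?_, ?_, ?_⟩
  · refine Integrable.add (Integrable.const_mul ?_ _) (hψL.2.const_mul _)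
    apply integrable_one_add_norm
    simp [hs0]
  · intro y
    have h1 := g_nonneg hg (t := 2 * P) (by positivity)
    have h2 := g_nonneg hg (t := w y) (hw0 y)
    positivity
  · intro x hx y hxy
    have hd : 0 < ‖x - y‖ := hρ.trans_le hxy
    have hne : x ≠ y := by
      rintro rfl
      simp at hd
    have hY : 0 < 1 + ‖y‖ := by positivity
    have hAd : 1 + ‖y‖ ≤ A * ‖x - y‖ := by
      have h1 : ‖y‖ ≤ ‖x‖ + ‖x - y‖ := by
        have := norm_sub_le x (x - y)
        simpa using this
      have h2 : ‖x‖ ≤ ‖xs‖ + ρ := by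
        rw [mem_ball, dist_eq_norm] at hx
        have := norm_add_le (x - xs) xs
        rw [sub_add_cancel] at this
        linarith
      have h3 : 1 + ‖xs‖ + ρ ≤ (1 + ‖xs‖ + ρ) / ρ * ‖x - y‖ := by
        rw [div_mul_eq_mul_div, le_div_iff₀ hρ]
        gcongr
      rw [hAdef, add_mul]
      linarith
    have hle : |ψ x - ψ y| / ‖x - y‖ ^ s ≤ A * (P + w y) := by
      rw [div_le_iff₀ (by positivity)]
      have h1 : |ψ x - ψ y| ≤ P + |ψ y| := by
        have := abs_sub (ψ x) (ψ y)
        have := hP x hx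
        linarith
      have h2 : (1 + ‖y‖) ^ s ≤ A * ‖x - y‖ ^ s := by
        calc (1 + ‖y‖) ^ s ≤ (A * ‖x - y‖) ^ s := by gcongr
          _ = A ^ s * ‖x - y‖ ^ s := Real.mul_rpow hA0.le hd.le
          _ ≤ A * ‖x - y‖ ^ s := by
            gcongr
            have := Real.rpow_le_rpow_of_exponent_le hA1 hs1.le
            simpa using this
      have h3 : 1 ≤ (1 + ‖y‖) ^ s := Real.one_le_rpow (by simp) hs0.le
      calc |ψ x - ψ y| ≤ P + |ψ y| := h1
        _ ≤ P * (1 + ‖y‖) ^ s + |ψ y| := by gcongr; nlinarith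
        _ = (P + w y) * (1 + ‖y‖) ^ s := by
          rw [hw]
          field_simp
        _ ≤ (P + w y) * (A * ‖x - y‖ ^ s) := by
          have := hw0 y
          gcongr
        _ = _ := by ring
    have hgb : |g ((ψ x - ψ y) / ‖x - y‖ ^ s)| ≤ C1 * (g (2 * P) + C2 * g (w y)) := by
      rw [g_abs hg, abs_div, abs_of_pos (show 0 < ‖x - y‖ ^ s by positivity)]
      calc _ ≤ g (A * (P + w y)) := hm hle
        _ ≤ C1 * g (P + w y) := hC1' _ (add_nonneg hP0 (hw0 y))
        _ ≤ _ := by gcongr; exact hsum y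
    have hkb : |K x y| / ‖x - y‖ ^ s ≤ Lam * A ^ ((n:ℝ) + s) * (1 + ‖y‖) ^ (-((n:ℝ) + s)) := by
      calc |K x y| / ‖x - y‖ ^ s ≤ Lam / ‖x - y‖ ^ n / ‖x - y‖ ^ s := by
            gcongr; exact k_bound hK hne
        _ = Lam / ‖x - y‖ ^ ((n:ℝ) + s) := by
          rw [Real.rpow_add hd, Real.rpow_natCast, div_div]
        _ ≤ Lam * A ^ ((n:ℝ) + s) / (1 + ‖y‖) ^ ((n:ℝ) + s) := by
          rw [div_le_div_iff₀ (by positivity) (by positivity), mul_assoc,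
            ← Real.mul_rpow hA0.le hd.le]
          gcongr
        _ = _ := by rw [Real.rpow_neg hY.le]; rfl
    have h2 := g_nonneg hg (t := w y) (hw0 y)
    have h1 := g_nonneg hg (t := 2 * P) (by positivity)
    calc |ff n s g K ψ x y| = |g ((ψ x - ψ y) / ‖x - y‖ ^ s)| * (|K x y| / ‖x - y‖ ^ s) := by
          unfold ff
          rw [abs_div, abs_mul, abs_of_pos (show 0 < ‖x - y‖ ^ s by positivity), mul_div_assoc]
      _ ≤ (C1 * (g (2 * P) + C2 * g (w y))) *
          (Lam * A ^ ((n:ℝ) + s) * (1 + ‖y‖) ^ (-((n:ℝ) + s))) := by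
          gcongr
      _ = _ := by
          simp only [hB, Real.rpow_neg hY.le]
          ring

theorem far_cont {n : ℕ} {s : ℝ} 
    {g : ℝ → ℝ} {pg qg : ℝ} (hg : CondG g pg qg)
    {K : Eucl n → Eucl n → ℝ} {lam Lam : ℝ} (hK : CondK n K lam Lam) {ψ : Eucl n → ℝ}
    (hψm : Measurable ψ) (xs : Eucl n) (hψc : ContinuousAt ψ xs) (ρ : ℝ) (hρ : 0 < ρ)
    (bd : Eucl n → ℝ) (hbd : Integrable bd) (hbd0 : ∀ y, 0 ≤ bd y)
    (hb : ∀ x ∈ ball xs ρ, ∀ y, ρ ≤ ‖x - y‖ → |ff n s g K ψ x y| ≤ bd y) :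
    ContinuousAt (fun x => ∫ y in (ball x ρ)ᶜ, ff n s g K ψ x y) xs ∧
    ∀ x ∈ ball xs ρ, IntegrableOn (ff n s g K ψ x) (ball x ρ)ᶜ := by
  have hbound : ∀ x ∈ ball xs ρ, ∀ y, ‖(ball x ρ)ᶜ.indicator (ff n s g K ψ x) y‖ ≤ bd y := by
    intro x hx y
    by_cases h : y ∈ (ball x ρ)ᶜ
    · rw [indicator_of_mem h]
      apply hb x hx y
      simpa [dist_eq_norm, norm_sub_rev] using h
    · rw [indicator_of_notMem h]
      simpa using hbd0 y
  have hmeas : ∀ x, AEStronglyMeasurable ((ball x ρ)ᶜ.indicator (ff n s g K ψ x)) volume :=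
    fun x => ((ff_meas hg hK hψm x).indicator measurableSet_ball.compl).aestronglyMeasurable
  constructor
  · have : (fun x => ∫ y in (ball x ρ)ᶜ, ff n s g K ψ x y) =
        fun x => ∫ y, (ball x ρ)ᶜ.indicator (ff n s g K ψ x) y := by
      funext x
      rw [integral_indicator measurableSet_ball.compl]
    rw [this]
    refine MeasureTheory.continuousAt_of_dominated (bound := bd) (Eventually.of_forall hmeas) ?_ hbd ?_
    · filter_upwards [ball_mem_nhds xs hρ] with x hx
      exact Eventually.of_forall (hbound x hx)
    · have hsph : ∀ᵐ y : Eucl n, y ∉ sphere xs ρ :=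
        measure_eq_zero_iff_ae_notMem.1 (Measure.addHaar_sphere_of_ne_zero volume xs hρ.ne')
      filter_upwards [hsph] with y hy
      have hdc : ContinuousAt (fun x => dist y x) xs := by fun_prop
      rcases lt_trichotomy (dist y xs) ρ with h | h | h
      · have hev : ∀ᶠ x in 𝓝 xs, dist y x < ρ := hdc.eventually_lt continuousAt_const h
        have : (fun x => (ball x ρ)ᶜ.indicator (ff n s g K ψ x) y) =ᶠ[𝓝 xs] fun _ => 0 := by
          filter_upwards [hev] with x hx
          rw [indicator_of_notMem]
          simpa using hx
        exact (continuousAt_congr this).2 continuousAt_const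
      · exact absurd h hy
      · have hev : ∀ᶠ x in 𝓝 xs, ρ < dist y x := continuousAt_const.eventually_lt hdc h
        have : (fun x => (ball x ρ)ᶜ.indicator (ff n s g K ψ x) y) =ᶠ[𝓝 xs]
            fun x => g ((ψ x - ψ y) / ‖x - y‖ ^ s) * K 0 (y - x) / ‖x - y‖ ^ s := by
          filter_upwards [hev] with x hx
          rw [indicator_of_mem, ff, K_eq hK x y]
          simpa using hx.le
        refine (continuousAt_congr this).2 ?_
        have hne : y - xs ≠ 0 := by
          intro h0
          rw [dist_eq_norm, h0, norm_zero] at h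
          linarith
        have hnn : ‖xs - y‖ ≠ 0 := by
          rw [norm_sub_rev]; exact norm_ne_zero_iff.2 hne
        have hpc : ContinuousAt (fun x => ‖x - y‖ ^ s) xs := by
          refine ContinuousAt.rpow_const ?_ (Or.inl hnn)
          fun_prop
        have hp0 : ‖xs - y‖ ^ s ≠ 0 := by
          have : 0 < ‖xs - y‖ := lt_of_le_of_ne (norm_nonneg _) hnn.symm
          positivity
        have hkc : ContinuousAt (fun x => K 0 (y - x)) xs := by
          have h1 : ContinuousAt (fun z => K 0 z) (y - xs) :=
            (k_cont hK).continuousAt (isOpen_compl_singleton.mem_nhds hne)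
          exact ContinuousAt.comp (f := fun x => y - x) (g := fun z => K 0 z) h1 (by fun_prop)
        have hgc : ContinuousAt (fun x => g ((ψ x - ψ y) / ‖x - y‖ ^ s)) xs :=
          ContinuousAt.comp (g := g) (g_cont hg).continuousAt
            ((hψc.sub continuousAt_const).div hpc hp0)
        exact (hgc.mul hkc).div hpc hp0
  · intro x hx
    rw [← integrable_indicator_iff measurableSet_ball.compl]
    exact hbd.mono' (hmeas x) (Eventually.of_forall (hbound x hx))

/-- The integrand in the variable `z = y - x`. -/
def hh (n : ℕ) (s : ℝ) (g : ℝ → ℝ) (K : Eucl n → Eucl n → ℝ) (ψ : Eucl n → ℝ)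
    (x z : Eucl n) : ℝ := ff n s g K ψ x (x + z)

/-- The symmetrized integrand. -/
def HH (n : ℕ) (s : ℝ) (g : ℝ → ℝ) (K : Eucl n → Eucl n → ℝ) (ψ : Eucl n → ℝ)
    (x z : Eucl n) : ℝ := (hh n s g K ψ x z + hh n s g K ψ x (-z)) / 2

theorem hh_eq {n : ℕ} {s : ℝ} {g : ℝ → ℝ}
    {K : Eucl n → Eucl n → ℝ} {lam Lam : ℝ} (hK : CondK n K lam Lam) (ψ : Eucl n → ℝ)
    (x z : Eucl n) :
    hh n s g K ψ x z = g ((ψ x - ψ (x + z)) / ‖z‖ ^ s) * K 0 z / ‖z‖ ^ s := by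
  unfold hh ff
  rw [K_eq hK x (x + z)]
  simp

theorem hh_meas {n : ℕ} {s : ℝ} {g : ℝ → ℝ} {pg qg : ℝ} (hg : CondG g pg qg)
    {K : Eucl n → Eucl n → ℝ} {lam Lam : ℝ} (hK : CondK n K lam Lam) {ψ : Eucl n → ℝ}
    (hψ : Measurable ψ) (x : Eucl n) : Measurable (hh n s g K ψ x) :=
  (ff_meas hg hK hψ x).comp (by fun_prop : Measurable (fun z => x + z))

theorem HH_meas {n : ℕ} {s : ℝ} {g : ℝ → ℝ} {pg qg : ℝ} (hg : CondG g pg qg)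
    {K : Eucl n → Eucl n → ℝ} {lam Lam : ℝ} (hK : CondK n K lam Lam) {ψ : Eucl n → ℝ}
    (hψ : Measurable ψ) (x : Eucl n) : Measurable (HH n s g K ψ x) :=
  ((hh_meas hg hK hψ x).add ((hh_meas hg hK hψ x).comp measurable_neg)).div_const 2

theorem near_bound {n : ℕ} {s : ℝ} (hs0 : 0 < s) (hs1 : s < 1)
    {g : ℝ → ℝ} {pg qg : ℝ} (hg : CondG g pg qg)
    {K : Eucl n → Eucl n → ℝ} {lam Lam : ℝ} (hK : CondK n K lam Lam) {ψ : Eucl n → ℝ}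
    (xs : Eucl n) (ρ L M : ℝ) (hρ : 0 < ρ) (hL : 0 ≤ L) (hM : 0 ≤ M)
    (hreg : ∀ x ∈ ball xs ρ, ∀ z : Eucl n, ‖z‖ < ρ → |ψ x - ψ (x + z)| ≤ L * ‖z‖ ∧
      |ψ (x + z) + ψ (x - z) - 2 * ψ x| ≤ M * ‖z‖ ^ 2) :
    ∃ C1 C2 : ℝ, 0 ≤ C1 ∧ 0 ≤ C2 ∧ ∀ x ∈ ball xs ρ, ∀ z : Eucl n, ‖z‖ < ρ →
      |HH n s g K ψ x z| ≤ C1 * ‖z‖ ^ (2 - 2 * s - n) ∧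
      ‖z‖ * |hh n s g K ψ x z| ≤ C2 * ‖z‖ ^ (2 - 2 * s - n) := by
  have hLam : 0 < Lam := hK.lam_pos.trans_le hK.lam_le_Lam
  obtain ⟨C, hC, hlip⟩ := g_lip hg (L * ρ ^ (1 - s)) (by positivity)
  refine ⟨C * M * Lam, C * L * Lam, by positivity, by positivity, ?_⟩
  intro x hx z hz
  rcases eq_or_ne z 0 with rfl | hz0
  · have h0 : hh n s g K ψ x 0 = 0 := by
      rw [hh_eq hK]
      simp [Real.zero_rpow hs0.ne']
    have h1 : HH n s g K ψ x 0 = 0 := by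
      unfold HH
      simp [h0]
    rw [h0, h1, abs_zero, mul_zero]
    constructor <;> positivity
  have ht : 0 < ‖z‖ := norm_pos_iff.2 hz0
  obtain ⟨r1, r2⟩ := hreg x hx z hz
  obtain ⟨r3, -⟩ := hreg x hx (-z) (by simpa using hz)
  rw [norm_neg, ← sub_eq_add_neg] at r3
  have hts : 0 < ‖z‖ ^ s := by positivity
  have hkb : |K 0 z| ≤ Lam / ‖z‖ ^ n := by
    have := k_bound hK (x := 0) (y := z) hz0.symm
    simpa using this
  have hT : ∀ u : ℝ, |u| ≤ L * ‖z‖ → |u / ‖z‖ ^ s| ≤ L * ρ ^ (1 - s) := by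
    intro u hu
    rw [abs_div, abs_of_pos hts, div_le_iff₀ hts]
    calc |u| ≤ L * ‖z‖ := hu
      _ = L * ‖z‖ ^ (1 - s) * ‖z‖ ^ s := by
        rw [mul_assoc, ← Real.rpow_add ht]; simp
      _ ≤ _ := by
        have : 0 ≤ 1 - s := by linarith
        gcongr
  have hpow : ∀ D : ℝ, D * ‖z‖ ^ 2 / ‖z‖ ^ s * (Lam / ‖z‖ ^ n) / ‖z‖ ^ s =
      D * Lam * ‖z‖ ^ (2 - 2 * s - n) := by
    intro D
    have : ‖z‖ ^ (2 - 2 * s - n) = ‖z‖ ^ 2 / ‖z‖ ^ s / ‖z‖ ^ s / ‖z‖ ^ n := by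
      rw [show (2 - 2 * s - n : ℝ) = (2 : ℕ) - s - s - n by push_cast; ring,
        Real.rpow_sub ht, Real.rpow_sub ht, Real.rpow_sub ht, Real.rpow_natCast, Real.rpow_natCast]
    rw [this]
    field_simp
  constructor
  · have e : HH n s g K ψ x z = (g ((ψ x - ψ (x + z)) / ‖z‖ ^ s) -
        g (-(ψ x - ψ (x - z)) / ‖z‖ ^ s)) * K 0 z / ‖z‖ ^ s / 2 := by
      unfold HH
      rw [hh_eq hK, hh_eq hK, K_neg hK, norm_neg, neg_div, hg.odd, ← sub_eq_add_neg x z]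
      ring
    have hl := hlip ((ψ x - ψ (x + z)) / ‖z‖ ^ s) (-(ψ x - ψ (x - z)) / ‖z‖ ^ s)
      (hT _ r1) (hT _ (by rwa [abs_neg]))
    have e2 : (ψ x - ψ (x + z)) / ‖z‖ ^ s - -(ψ x - ψ (x - z)) / ‖z‖ ^ s =
        -(ψ (x + z) + ψ (x - z) - 2 * ψ x) / ‖z‖ ^ s := by ring
    rw [e2, abs_div, abs_neg, abs_of_pos hts] at hl
    rw [e, abs_div, abs_div, abs_mul, abs_of_pos hts, abs_two]
    calc _ ≤ (C * (M * ‖z‖ ^ 2 / ‖z‖ ^ s)) * (Lam / ‖z‖ ^ n) / ‖z‖ ^ s / 2 := by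
          gcongr
          exact hl.trans (by gcongr)
      _ ≤ (C * (M * ‖z‖ ^ 2 / ‖z‖ ^ s)) * (Lam / ‖z‖ ^ n) / ‖z‖ ^ s :=
          half_le_self (by positivity)
      _ = (C * M) * ‖z‖ ^ 2 / ‖z‖ ^ s * (Lam / ‖z‖ ^ n) / ‖z‖ ^ s := by ring
      _ = _ := hpow _
  · have hl := hlip ((ψ x - ψ (x + z)) / ‖z‖ ^ s) 0 (hT _ r1) (by simp; positivity)
    rw [hg.zero, sub_zero, sub_zero, abs_div, abs_of_pos hts] at hl
    rw [hh_eq hK, abs_div, abs_mul, abs_of_pos hts]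
    calc _ ≤ ‖z‖ * ((C * (L * ‖z‖ / ‖z‖ ^ s)) * (Lam / ‖z‖ ^ n) / ‖z‖ ^ s) := by
          gcongr
          exact hl.trans (by gcongr)
      _ = (C * L) * ‖z‖ ^ 2 / ‖z‖ ^ s * (Lam / ‖z‖ ^ n) / ‖z‖ ^ s := by ring
      _ = _ := hpow _

theorem annulus {n : ℕ} {s : ℝ} {g : ℝ → ℝ} {pg qg : ℝ} (hg : CondG g pg qg)
    {K : Eucl n → Eucl n → ℝ} {lam Lam : ℝ} (hK : CondK n K lam Lam) {ψ : Eucl n → ℝ}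
    (hψ : Measurable ψ) (x : Eucl n) (ρ ε C2 : ℝ) (hε : 0 < ε)
    (hint : IntegrableOn (fun z : Eucl n => ‖z‖ ^ (2 - 2 * s - n)) (ball 0 ρ))
    (hb : ∀ z : Eucl n, ‖z‖ < ρ → ‖z‖ * |hh n s g K ψ x z| ≤ C2 * ‖z‖ ^ (2 - 2 * s - n)) :
    IntegrableOn (ff n s g K ψ x) (ball x ρ \ ball x ε) ∧
    ∫ y in ball x ρ \ ball x ε, ff n s g K ψ x y =
      ∫ z in ball (0 : Eucl n) ρ, (ball (0 : Eucl n) ε)ᶜ.indicator (HH n s g K ψ x) z := by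
  have hmA : MeasurableSet (ball (0 : Eucl n) ρ \ ball 0 ε) := measurableSet_ball.diff measurableSet_ball
  have hmB : MeasurableSet (ball x ρ \ ball x ε) := measurableSet_ball.diff measurableSet_ball
  have htr : ∀ z, (ball x ρ \ ball x ε).indicator (ff n s g K ψ x) (x + z) =
      (ball (0 : Eucl n) ρ \ ball 0 ε).indicator (hh n s g K ψ x) z := by
    intro z
    have : x + z ∈ ball x ρ \ ball x ε ↔ z ∈ ball (0 : Eucl n) ρ \ ball 0 ε := by
      simp [dist_eq_norm]
    by_cases h : z ∈ ball (0 : Eucl n) ρ \ ball 0 ε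
    · rw [indicator_of_mem h, indicator_of_mem (this.2 h), hh]
    · rw [indicator_of_notMem h, indicator_of_notMem (fun h' => h (this.1 h'))]
  have hI : Integrable ((ball (0 : Eucl n) ρ \ ball 0 ε).indicator (hh n s g K ψ x)) := by
    rw [integrable_indicator_iff hmA]
    have h1 : IntegrableOn (fun z : Eucl n => C2 / ε * ‖z‖ ^ (2 - 2 * s - n))
        (ball (0 : Eucl n) ρ \ ball 0 ε) := (hint.mono_set sdiff_subset).const_mul _
    refine Integrable.mono' h1 (hh_meas hg hK hψ x).aestronglyMeasurable ?_
    refine (ae_restrict_iff' hmA).2 (Eventually.of_forall ?_)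
    intro z hz
    have hz1 : ‖z‖ < ρ := by simpa using hz.1
    have hz2 : ε ≤ ‖z‖ := by simpa using hz.2
    have := hb z hz1
    rw [Real.norm_eq_abs, div_mul_eq_mul_div, le_div_iff₀ hε]
    have h3 : ε * |hh n s g K ψ x z| ≤ ‖z‖ * |hh n s g K ψ x z| := by gcongr
    linarith
  have hI2 : Integrable ((ball x ρ \ ball x ε).indicator (ff n s g K ψ x)) := by
    have h1 : Integrable (fun z => (ball x ρ \ ball x ε).indicator (ff n s g K ψ x) (x + z)) := by
      simp_rw [htr]; exact hI
    have h2 := h1.comp_add_left (-x)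
    simpa using h2
  refine ⟨(integrable_indicator_iff hmB).1 hI2, ?_⟩
  rw [← integral_indicator hmB,
    ← integral_add_left_eq_self (μ := volume) (ball x ρ \ ball x ε |>.indicator (ff n s g K ψ x)) x]
  simp_rw [htr]
  rw [setIntegral_indicator measurableSet_ball.compl, ← sdiff_eq, ← integral_indicator hmA]
  set f := (ball (0 : Eucl n) ρ \ ball 0 ε).indicator (hh n s g K ψ x) with hf
  have e : ∀ z, (ball (0 : Eucl n) ρ \ ball 0 ε).indicator (HH n s g K ψ x) z =
      (f z + f (-z)) / 2 := by
    intro z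
    have : -z ∈ ball (0 : Eucl n) ρ \ ball 0 ε ↔ z ∈ ball (0 : Eucl n) ρ \ ball 0 ε := by
      simp
    by_cases h : z ∈ ball (0 : Eucl n) ρ \ ball 0 ε
    · rw [hf, indicator_of_mem h, indicator_of_mem h, indicator_of_mem (this.2 h), HH]
    · rw [hf, indicator_of_notMem h, indicator_of_notMem h,
        indicator_of_notMem (fun h' => h (this.1 h'))]
      simp
  simp_rw [e]
  rw [integral_div, integral_add hI hI.comp_neg, integral_neg_eq_self f]
  ring

theorem loc {n : ℕ} (hn : 1 ≤ n) {s : ℝ} (hs0 : 0 < s) (hs1 : s < 1)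
    {g : ℝ → ℝ} {pg qg : ℝ} (hg : CondG g pg qg)
    {K : Eucl n → Eucl n → ℝ} {lam Lam : ℝ} (hK : CondK n K lam Lam)
    {x₀ : Eucl n} {r : ℝ} {ψ : Eucl n → ℝ} (hψC2 : ContDiffOn ℝ 2 ψ (ball x₀ r))
    (hψL : MemLgs n s g ψ) {xs : Eucl n} (hxs : xs ∈ ball x₀ r) :
    ∃ Φ : Eucl n → ℝ, ContinuousAt Φ xs ∧ ∀ᶠ x in 𝓝 xs, Lpv n s g K ψ x (Φ x) := by
  obtain ⟨ρ, L, M, hρ, hL, hM, hreg⟩ := reg hψC2 hxs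
  have hψm := hψL.1
  have hψc : ∀ x ∈ ball x₀ r, ContinuousAt ψ x := fun x hx =>
    hψC2.continuousOn.continuousAt (isOpen_ball.mem_nhds hx)
  obtain ⟨C1, C2, hC1, hC2, hnb⟩ := near_bound hs0 hs1 hg hK xs ρ L M hρ hL hM
    (fun x hx z hz => ((hreg x hx).2 z hz).2)
  have hP : ∀ x ∈ ball xs ρ, |ψ x| ≤ |ψ xs| + L * ρ := by
    intro x hx
    have hx' : ‖x - xs‖ < ρ := by rwa [mem_ball, dist_eq_norm] at hx
    have h1 := ((hreg xs (mem_ball_self hρ)).2 (x - xs) hx').2.1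
    rw [add_sub_cancel, abs_sub_comm] at h1
    have h2 : L * ‖x - xs‖ ≤ L * ρ := by gcongr
    have h3 := abs_sub_abs_le_abs_sub (ψ x) (ψ xs)
    linarith
  obtain ⟨bd, hbd, hbd0, hbd'⟩ := far_bound hs0 hs1 hg hK hψL xs ρ _ hρ hP
  obtain ⟨hfc, hfi⟩ := far_cont hg hK hψm xs (hψc xs hxs) ρ hρ bd hbd hbd0 hbd'
  have hint : IntegrableOn (fun z : Eucl n => ‖z‖ ^ (2 - 2 * s - n)) (ball 0 ρ) :=
    int_pow hn (by linarith) ρ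
  have hnc : ContinuousAt (fun x => ∫ z in ball (0 : Eucl n) ρ, HH n s g K ψ x z) xs := by
    refine MeasureTheory.continuousAt_of_dominated
      (bound := fun z => C1 * ‖z‖ ^ (2 - 2 * s - n))
      (Eventually.of_forall fun x => (HH_meas hg hK hψm x).aestronglyMeasurable) ?_
      (hint.const_mul _) ?_
    · filter_upwards [ball_mem_nhds xs hρ] with x hx
      refine (ae_restrict_iff' measurableSet_ball).2 (Eventually.of_forall fun z hz => ?_)
      exact (hnb x hx z (by simpa using hz)).1
    · refine (ae_restrict_iff' measurableSet_ball).2 (Eventually.of_forall fun z hz => ?_)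
      have key : ∀ z : Eucl n, ‖z‖ < ρ → ContinuousAt (fun x => hh n s g K ψ x z) xs := by
        intro z hz
        simp_rw [hh_eq hK]
        have hc2 : ContinuousAt (fun x => ψ (x + z)) xs :=
          ContinuousAt.comp (f := fun x => x + z) (g := ψ)
            (hψc _ ((hreg xs (mem_ball_self hρ)).2 z hz).1) (by fun_prop)
        have hgc : ContinuousAt (fun x => g ((ψ x - ψ (x + z)) / ‖z‖ ^ s)) xs :=
          ContinuousAt.comp (g := g) (g_cont hg).continuousAt
            (((hψc xs hxs).sub hc2).div_const _)
        exact (hgc.mul continuousAt_const).div_const _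
      have hz' : ‖z‖ < ρ := by simpa using hz
      exact ((key z hz').add (key (-z) (by simpa using hz'))).div_const 2
  refine ⟨_, hfc.add hnc, ?_⟩
  filter_upwards [ball_mem_nhds xs hρ] with x hx
  have hlim : Tendsto (fun ε : ℝ => ∫ z in ball (0 : Eucl n) ρ,
      (ball (0 : Eucl n) ε)ᶜ.indicator (HH n s g K ψ x) z) (𝓝[>] 0)
      (𝓝 (∫ z in ball (0 : Eucl n) ρ, HH n s g K ψ x z)) := by
    refine tendsto_integral_filter_of_dominated_convergence
      (fun z => C1 * ‖z‖ ^ (2 - 2 * s - n)) ?_ ?_ (hint.const_mul _) ?_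
    · exact Eventually.of_forall fun ε =>
        ((HH_meas hg hK hψm x).indicator measurableSet_ball.compl).aestronglyMeasurable
    · refine Eventually.of_forall fun ε => ?_
      refine (ae_restrict_iff' measurableSet_ball).2 (Eventually.of_forall fun z hz => ?_)
      refine (norm_indicator_le_norm_self _ _).trans ?_
      exact (hnb x hx z (by simpa using hz)).1
    · refine Eventually.of_forall fun z => ?_
      rcases eq_or_ne z 0 with rfl | hz
      · have h0 : HH n s g K ψ x 0 = 0 := by
          unfold HH
          rw [neg_zero, hh_eq hK]
          simp [Real.zero_rpow hs0.ne']
        rw [h0]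
        refine tendsto_const_nhds.congr fun ε => ?_
        by_cases h : (0 : Eucl n) ∈ (ball (0 : Eucl n) ε)ᶜ
        · rw [indicator_of_mem h, h0]
        · rw [indicator_of_notMem h]
      · refine tendsto_const_nhds.congr' ?_
        have : ∀ᶠ ε : ℝ in 𝓝[>] 0, ε < ‖z‖ :=
          nhdsWithin_le_nhds (Iio_mem_nhds (norm_pos_iff.2 hz))
        filter_upwards [this] with ε hε
        rw [indicator_of_mem]
        simpa using hε.le
  unfold Lpv
  refine (tendsto_const_nhds.add hlim).congr' ?_
  have hev : ∀ᶠ ε : ℝ in 𝓝[>] 0, ε < ρ := nhdsWithin_le_nhds (Iio_mem_nhds hρ)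
  filter_upwards [hev, self_mem_nhdsWithin] with ε hε1 hε0
  obtain ⟨ha1, ha2⟩ := annulus hg hK hψm x ρ ε C2 hε0 hint (fun z hz => (hnb x hx z hz).2)
  rw [← ha2]
  have hset : (ball x ε)ᶜ = (ball x ρ)ᶜ ∪ (ball x ρ \ ball x ε) := by
    ext y
    have : y ∈ ball x ε → y ∈ ball x ρ := fun h => ball_subset_ball hε1.le h
    simp only [mem_compl_iff, mem_union, Set.mem_sdiff]
    tauto
  rw [hset]
  symm
  refine setIntegral_union ?_ (measurableSet_ball.diff measurableSet_ball) (hfi x hx) ha1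
  exact disjoint_left.2 fun y h1 h2 => h1 h2.1

end LpsiAux

/-- Lemma 2.3: continuity of `𝓛ψ` for admissible test
functions `ψ ∈ C²(B_r(x₀)) ∩ L^g_s(ℝⁿ)`; in the singular range
`1 < p ≤ 2/(2-s)` (with `p = p_g + 1`) one additionally assumes
`ψ ∈ C²_β(B_r(x₀))` for some `β > sp/(p-1) = s(p_g+1)/p_g`, `Dψ(x₀) = 0` and
that `x₀` is an isolated critical point of `ψ`.  The conclusion asserts that
the principal value `𝓛ψ(x)` exists for every `x ∈ B_r(x₀)` and defines a
continuous function there. -/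
theorem Lpsi_continuous
    (n : ℕ) (hn : 1 ≤ n) (s : ℝ) (hs0 : 0 < s) (hs1 : s < 1)
    (g : ℝ → ℝ) (pg qg : ℝ) (hg : CondG g pg qg)
    (K : Eucl n → Eucl n → ℝ) (lam Lam : ℝ) (hK : CondK n K lam Lam)
    (Ω : Set (Eucl n)) (hΩo : IsOpen Ω) (hΩb : IsBounded Ω)
    (x₀ : Eucl n) (r : ℝ) (hr : 0 < r) (hball : ball x₀ r ⊆ Ω)
    (ψ : Eucl n → ℝ) (hψC2 : ContDiffOn ℝ 2 ψ (ball x₀ r))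
    (hψL : MemLgs n s g ψ)
    (hsing : pg + 1 ≤ 2 / (2 - s) →
      (∃ β : ℝ, s * (pg + 1) / pg < β ∧ C2beta n ψ (ball x₀ r) β) ∧
      fderiv ℝ ψ x₀ = 0 ∧
      (∃ ε : ℝ, 0 < ε ∧ ∀ z ∈ ball x₀ ε, z ≠ x₀ → fderiv ℝ ψ z ≠ 0)) :
    ∃ F : Eucl n → ℝ, ContinuousOn F (ball x₀ r) ∧
      ∀ x ∈ ball x₀ r, Lpv n s g K ψ x (F x) := by
  choose! Φ hΦc hΦ using fun xs (hxs : xs ∈ ball x₀ r) =>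
    LpsiAux.loc hn hs0 hs1 hg hK hψC2 hψL hxs
  refine ⟨fun x => Φ x x, ?_, fun x hx => (hΦ x hx).self_of_nhds⟩
  intro xs hxs
  refine ContinuousAt.continuousWithinAt ?_
  refine (continuousAt_congr ?_).2 (hΦc xs hxs)
  filter_upwards [hΦ xs hxs, isOpen_ball.mem_nhds hxs] with x h1 h2
  exact tendsto_nhds_unique (hΦ x h2).self_of_nhds h1
end
end
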